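/- arXiv:1706.06310 — 2 statements merged into one kernel-verified Lean document; each statement's English description precedes it below -/
import Mathlib

section
/- Let n ≥ 1, let Ω ⊆ ℝ^n be an open convex set, let 0 < λ1 < λ2, and let v be a nonnegative convex function on Ω satisfying λ1·H^n(ω) ≤ μ_v(ω) ≤ λ2·H^n(ω) for every Borel set ω ⊆ Ω. If the zero set S = {x ∈ Ω : v(x) = 0} contains at least two points, then S has no extremal point: for every z ∈ S there exist x₁, x₂ ∈ S and α ∈ (0,1) with z = α·x₁ + (1−α)·x₂ and not both x₁ = z and x₂ = z. -/
open MeasureTheory Set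
open scoped ENNReal NNReal RealInnerProductSpace

noncomputable section

/-- Support function of a set `K`. -/
def suppFn {n : ℕ} (K : Set (EuclideanSpace ℝ (Fin n))) (u : EuclideanSpace ℝ (Fin n)) : ℝ :=
  sSup ((fun y => ⟪u, y⟫) '' K)

/-- Face of `K` with outer normal `u`. -/
def face {n : ℕ} (K : Set (EuclideanSpace ℝ (Fin n))) (u : EuclideanSpace ℝ (Fin n)) :
    Set (EuclideanSpace ℝ (Fin n)) :=
  {z ∈ K | ⟪z, u⟫ = suppFn K u}

/-- Normal cone of `K` at `z`. -/
def normalCone {n : ℕ} (K : Set (EuclideanSpace ℝ (Fin n))) (z : EuclideanSpace ℝ (Fin n)) :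
    Set (EuclideanSpace ℝ (Fin n)) :=
  {u | ∀ y ∈ K, ⟪u, y⟫ ≤ ⟪u, z⟫}

/-- The unit sphere `S^{n-1}` in `ℝ^n`. -/
def unitSphere (n : ℕ) : Set (EuclideanSpace ℝ (Fin n)) :=
  Metric.sphere (0 : EuclideanSpace ℝ (Fin n)) 1

/-- Surface area measure of `K` evaluated on `ω`:
`S_K(ω) = H^{n-1}(⋃_{u ∈ ω} F(K,u))`. -/
def surfMeas {n : ℕ} (K : Set (EuclideanSpace ℝ (Fin n)))
    (ω : Set (EuclideanSpace ℝ (Fin n))) : ℝ≥0∞ :=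
  μH[(n : ℝ) - 1] (⋃ u ∈ ω, face K u)

/-- `K ∈ 𝒦₀ⁿ`: compact convex with nonempty interior, containing the origin. -/
def IsConvexBody0 {n : ℕ} (K : Set (EuclideanSpace ℝ (Fin n))) : Prop :=
  IsCompact K ∧ Convex ℝ K ∧ (interior K).Nonempty ∧ (0 : EuclideanSpace ℝ (Fin n)) ∈ K

/-- `K` is a solution of the `L_p` Minkowski problem `dS_{K,p} = f dH^{n-1}`. -/
def IsLpSolution {n : ℕ} (p : ℝ) (f : EuclideanSpace ℝ (Fin n) → ℝ)
    (K : Set (EuclideanSpace ℝ (Fin n))) : Prop :=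
  μH[(n : ℝ) - 1] {u ∈ unitSphere n | suppFn K u = 0} = 0 ∧
  ∀ ω : Set (EuclideanSpace ℝ (Fin n)), MeasurableSet ω →
    ω ⊆ {u ∈ unitSphere n | 0 < suppFn K u} →
    surfMeas K ω
      = ∫⁻ u in ω, ENNReal.ofReal ((n : ℝ) * f u * suppFn K u ^ (p - 1)) ∂μH[(n : ℝ) - 1]

/-- `x` is a smooth boundary point: the normal cone spans a one-dimensional space. -/
def IsSmoothPt {n : ℕ} (K : Set (EuclideanSpace ℝ (Fin n)))
    (x : EuclideanSpace ℝ (Fin n)) : Prop :=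
  Module.finrank ℝ (Submodule.span ℝ (normalCone K x)) = 1

/-- `K` is smooth: every boundary point is a smooth point. -/
def IsSmoothBody {n : ℕ} (K : Set (EuclideanSpace ℝ (Fin n))) : Prop :=
  ∀ x ∈ frontier K, IsSmoothPt K x

/-- Subgradient of `v` at `x` relative to the domain `Ω`. -/
def subgrad {n : ℕ} (Ω : Set (EuclideanSpace ℝ (Fin n))) (v : EuclideanSpace ℝ (Fin n) → ℝ)
    (x : EuclideanSpace ℝ (Fin n)) : Set (EuclideanSpace ℝ (Fin n)) :=
  {z | ∀ y ∈ Ω, v x + ⟪z, y - x⟫ ≤ v y}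

/-- Monge–Ampère measure of `v` (relative to domain `Ω`) evaluated on `ω`. -/
def maMeasure {n : ℕ} (Ω : Set (EuclideanSpace ℝ (Fin n))) (v : EuclideanSpace ℝ (Fin n) → ℝ)
    (ω : Set (EuclideanSpace ℝ (Fin n))) : ℝ≥0∞ :=
  μH[(n : ℝ)] (⋃ x ∈ ω, subgrad Ω v x)

/-- Hessian matrix of `v : ℝ^n → ℝ` at `x`. -/
def hessMatrix {n : ℕ} (v : EuclideanSpace ℝ (Fin n) → ℝ) (x : EuclideanSpace ℝ (Fin n)) :
    Matrix (Fin n) (Fin n) ℝ :=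
  Matrix.of fun i j =>
    fderiv ℝ (fun y => fderiv ℝ v y (EuclideanSpace.single j 1)) x (EuclideanSpace.single i 1)

theorem aux_milman {E : Type*} [NormedAddCommGroup E] [NormedSpace ℝ E]
    {K C : Set E} {z : E} (hK : Convex ℝ K) (hC : IsCompact C) (hKc : IsCompact K) (hCK : C ⊆ K)
    (hz : z ∈ K.extremePoints ℝ) (hzC : z ∉ C) :
    ∃ T : Set E, IsCompact T ∧ Convex ℝ T ∧ T ⊆ K ∧ C ⊆ T ∧ z ∉ T := by
  refine hC.induction_on (p := fun s => ∃ T : Set E, IsCompact T ∧ Convex ℝ T ∧ T ⊆ K ∧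
    s ⊆ T ∧ z ∉ T) ?_ ?_ ?_ ?_
  · exact ⟨∅, isCompact_empty, convex_empty, by simp, by simp, by simp⟩
  · rintro s t hst ⟨T, h1, h2, h3, h4, h5⟩
    exact ⟨T, h1, h2, h3, hst.trans h4, h5⟩
  · rintro s t ⟨T, h1, h2, h3, h4, h5⟩ ⟨U, g1, g2, g3, g4, g5⟩
    rcases T.eq_empty_or_nonempty with rfl | hT
    · refine ⟨U, g1, g2, g3, union_subset (h4.trans (by simp)) g4, g5⟩
    rcases U.eq_empty_or_nonempty with rfl | hU
    · refine ⟨T, h1, h2, h3, union_subset h4 (g4.trans (by simp)), h5⟩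
    refine ⟨convexJoin ℝ T U, ?_, h2.convexJoin g2, convexJoin_subset h3 g3 hK,
      union_subset (h4.trans (subset_convexJoin_left hU))
        (g4.trans (subset_convexJoin_right hT)), ?_⟩
    · have : convexJoin ℝ T U =
          (fun q : (E × E) × ℝ => (1 - q.2) • q.1.1 + q.2 • q.1.2) '' ((T ×ˢ U) ×ˢ Icc (0:ℝ) 1) := by
        ext x
        simp only [mem_convexJoin, segment_eq_image, mem_image, mem_prod, Prod.exists]
        constructor
        · rintro ⟨a, ha, b, hb, t, ht, rfl⟩
          exact ⟨a, b, t, ⟨⟨ha, hb⟩, ht⟩, rfl⟩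
        · rintro ⟨a, b, t, ⟨⟨ha, hb⟩, ht⟩, rfl⟩
          exact ⟨a, ha, b, hb, t, ht, rfl⟩
      rw [this]
      apply ((h1.prod g1).prod isCompact_Icc).image
      fun_prop
    · rw [mem_convexJoin]
      rintro ⟨a, ha, b, hb, hab⟩
      rcases (mem_extremePoints_iff_forall_segment.1 hz).2 a (h3 ha) b (g3 hb) hab with h | h
      · exact h5 (h ▸ ha)
      · exact g5 (h ▸ hb)
  · intro x hx
    have hxz : 0 < dist z x := by
      rw [dist_pos]; rintro rfl; exact hzC hx
    refine ⟨Metric.closedBall x (dist z x / 2) ∩ C, ?_, Metric.closedBall x (dist z x / 2) ∩ K,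
      ?_, ?_, inter_subset_right, inter_subset_inter_right _ hCK, ?_⟩
    · rw [inter_comm]
      exact inter_mem_nhdsWithin _ (Metric.closedBall_mem_nhds _ (by positivity))
    · exact hKc.inter_left Metric.isClosed_closedBall
    · exact (convex_closedBall _ _).inter hK
    · rintro ⟨h, -⟩
      rw [Metric.mem_closedBall] at h
      linarith

theorem aux_cap {n : ℕ} {K : Set (EuclideanSpace ℝ (Fin n))} {z : EuclideanSpace ℝ (Fin n)}
    (hK : Convex ℝ K) (hKc : IsCompact K) (hz : z ∈ K.extremePoints ℝ) {r : ℝ} (hr : 0 < r) :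
    ∃ (e : EuclideanSpace ℝ (Fin n)) (c : ℝ), c < ⟪e, z⟫ ∧
      ∀ y ∈ K, c ≤ ⟪e, y⟫ → dist y z < r := by
  obtain ⟨T, h1, h2, h3, h4, h5⟩ := aux_milman (C := K \ Metric.ball z r) hK
    (hKc.diff Metric.isOpen_ball) hKc sdiff_subset hz (by simp [hr])
  obtain ⟨f, u, hf, hu⟩ := geometric_hahn_banach_closed_point h2 h1.isClosed h5
  refine ⟨(InnerProductSpace.toDual ℝ _).symm f, u, by simpa using hu, ?_⟩
  intro y hy hc
  by_contra h
  have := hf y (h4 ⟨hy, by simpa using h⟩)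
  simp at hc
  linarith

/-- the volume concentration lemma -/
theorem aux_vol {n : ℕ} (μ : Measure (EuclideanSpace ℝ (Fin n))) [μ.IsAddHaarMeasure]
    {P : Set (EuclideanSpace ℝ (Fin n))} (hP : Convex ℝ P) (hPm : IsClosed P)
    {E W : EuclideanSpace ℝ (Fin n)} (hE : E ∈ P) (hW : ∀ p ∈ P, ⟪p, W⟫ ≤ 1) {N : ℕ}
    (hN : ⟪E, W⟫ < - (6 * N : ℝ)) :
    (N : ℝ≥0∞) * μ (P ∩ {p | -2 ≤ ⟪p, W⟫}) ≤ 2 ^ n * μ P := by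
  rcases Nat.eq_zero_or_pos N with rfl | hN0
  · simp
  have hN0' : (0:ℝ) < N := by exact_mod_cast hN0
  set A := P ∩ {p | -2 ≤ ⟪p, W⟫} with hA
  have hAc : IsClosed A := hPm.inter (isClosed_le continuous_const (by fun_prop))
  let s : ℕ → ℝ := fun j => j / (2 * N)
  have hs0 : ∀ j, 0 ≤ s j := fun j => by positivity
  have hs1 : ∀ j < N, s j ≤ 1 / 2 := fun j hj => by
    have : (j:ℝ) ≤ N := by exact_mod_cast hj.le
    simp only [s]
    rw [div_le_iff₀ (by positivity)]
    linarith
  let F : ℕ → Set (EuclideanSpace ℝ (Fin n)) := fun j => AffineMap.homothety E (1 - s j) '' A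
  have hF : ∀ j p, AffineMap.homothety E (1 - s j) p = (1 - s j) • p + s j • E := by
    intro j p
    simp only [AffineMap.homothety_apply, vsub_eq_sub, vadd_eq_add]
    module
  have hFc : ∀ j < N, IsClosed (F j) := by
    intro j hj
    have h0 : (1 - s j) ≠ 0 := by linarith [hs1 j hj]
    have : F j = (fun q => (1 - s j)⁻¹ • (q - s j • E)) ⁻¹' A := by
      ext q
      simp only [F, mem_image, mem_preimage, hF]
      constructor
      · rintro ⟨p, hp, rfl⟩
        rwa [add_sub_cancel_right, inv_smul_smul₀ h0]
      · intro h
        exact ⟨_, h, by rw [smul_inv_smul₀ h0, sub_add_cancel]⟩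
    rw [this]
    exact hAc.preimage (by fun_prop)
  have hFP : ∀ j < N, F j ⊆ P := by
    rintro j hj _ ⟨p, hp, rfl⟩
    rw [hF]
    exact hP hp.1 hE (by linarith [hs1 j hj]) (hs0 j) (by ring)
  have hdis : ∀ i j, i < j → j < N → Disjoint (F i) (F j) := by
    intro i j hij hj
    rw [Set.disjoint_left]
    rintro _ ⟨p, hp, rfl⟩ ⟨q, hq, hpq⟩
    rw [hF, hF] at hpq
    have h := congrArg (fun t => ⟪t, W⟫) hpq
    simp only [inner_add_left, real_inner_smul_left] at h
    have h1 := hp.2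
    have h2 := hW q hq.1
    simp only [mem_ofPred_eq] at h1
    have hsi := hs1 i (hij.trans hj)
    have hsj := hs1 j hj
    have hd : s j - s i ≥ 1 / (2 * N) := by
      simp only [s]
      rw [ge_iff_le, ← sub_div]
      gcongr
      have : ((i + 1 : ℕ) : ℝ) ≤ j := by exact_mod_cast hij
      push_cast at this; linarith
    have h3 : (1 - s j) * ⟪q, W⟫ ≤ 1 := by nlinarith [hs0 j]
    have h4 : (1 - s i) * ⟪p, W⟫ ≥ -2 := by nlinarith [hs0 i]
    have h5 : (s j - s i) * (6 * N) ≥ 3 := by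
      calc (s j - s i) * (6 * N) ≥ 1 / (2 * N) * (6 * N) := by gcongr
        _ = 3 := by field_simp; norm_num
    have h6 : 0 < s j - s i := lt_of_lt_of_le (by positivity) hd
    nlinarith
  have hvol : ∀ j < N, μ A ≤ 2 ^ n * μ (F j) := by
    intro j hj
    have h0 : (1/2:ℝ) ≤ (1 - s j) := by linarith [hs1 j hj]
    rw [show F j = AffineMap.homothety E (1 - s j) '' A from rfl, Measure.addHaar_image_homothety,
      ← mul_assoc, finrank_euclideanSpace_fin]
    have : (1 : ℝ≥0∞) ≤ 2 ^ n * ENNReal.ofReal |(1 - s j) ^ n| := by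
      rw [abs_of_nonneg (by positivity), show (2:ℝ≥0∞) = ENNReal.ofReal 2 by simp,
        ← ENNReal.ofReal_pow (by norm_num), ← ENNReal.ofReal_mul (by positivity), ← mul_pow,
        ENNReal.one_le_ofReal]
      exact one_le_pow₀ (by linarith)
    calc μ A = 1 * μ A := by simp
      _ ≤ _ := by gcongr
  calc (N : ℝ≥0∞) * μ A = ∑ j ∈ Finset.range N, μ A := by simp
    _ ≤ ∑ j ∈ Finset.range N, 2 ^ n * μ (F j) :=
        Finset.sum_le_sum fun j hj => hvol j (Finset.mem_range.1 hj)
    _ = 2 ^ n * ∑ j ∈ Finset.range N, μ (F j) := by rw [Finset.mul_sum]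
    _ = 2 ^ n * μ (⋃ j ∈ Finset.range N, F j) := by
        rw [measure_biUnion_finset]
        · intro i hi j hj hij
          simp only [Finset.coe_range, mem_Iio] at hi hj
          rcases lt_or_gt_of_ne hij with h | h
          · exact hdis i j h hj
          · exact (hdis j i h hi).symm
        · intro j hj
          exact (hFc j (Finset.mem_range.1 hj)).measurableSet
    _ ≤ 2 ^ n * μ P := by
        gcongr
        exact iUnion₂_subset fun j hj => hFP j (Finset.mem_range.1 hj)

section
open scoped Pointwise

theorem aux_sub {n : ℕ} {Ω : Set (EuclideanSpace ℝ (Fin n))}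
    (hΩo : IsOpen Ω) {u : EuclideanSpace ℝ (Fin n) → ℝ}
    (hu : ConvexOn ℝ Ω u) {B : Set (EuclideanSpace ℝ (Fin n))} (hB : IsCompact B) (hBΩ : B ⊆ Ω)
    (hZB : {y ∈ Ω | u y < 0} ⊆ B) {z p : EuclideanSpace ℝ (Fin n)} (hz : z ∈ Ω) (hz0 : u z < 0)
    (hp : ∀ y ∈ Ω, u y < 0 → ⟪p, y - z⟫ ≤ - u z) :
    ∃ x ∈ {y ∈ Ω | u y < 0}, p ∈ subgrad Ω u x := by
  have huc : ContinuousOn u Ω := hu.continuousOn hΩo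
  set Z := {y ∈ Ω | u y < 0} with hZ
  have hZo : IsOpen Z := huc.isOpen_inter_preimage hΩo isOpen_Iio
  have hclB : closure Z ⊆ B := closure_minimal hZB hB.isClosed
  have hclc : IsCompact (closure Z) := hB.of_isClosed_subset isClosed_closure hclB
  let g : EuclideanSpace ℝ (Fin n) → ℝ := fun y => u y - ⟪p, y - z⟫
  have hgc : ContinuousOn g Ω := huc.sub (by fun_prop)
  have hzZ : z ∈ Z := ⟨hz, hz0⟩
  obtain ⟨x, hx, hmin⟩ := hclc.exists_isMinOn ⟨z, subset_closure hzZ⟩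
    (hgc.mono (hclB.trans hBΩ))
  have key : ∃ x ∈ Z, ∀ y ∈ Z, g x ≤ g y := by
    by_cases hxZ : x ∈ Z
    · exact ⟨x, hxZ, fun y hy => hmin (subset_closure hy)⟩
    · have hux : 0 ≤ u x := by
        by_contra h
        exact hxZ ⟨hBΩ (hclB hx), not_le.1 h⟩
      have hpx : ⟪p, x - z⟫ ≤ - u z := by
        have : IsClosed {y | ⟪p, y - z⟫ ≤ - u z} := isClosed_le (by fun_prop) continuous_const
        exact closure_minimal (fun y hy => hp y hy.1 hy.2) this hx
      refine ⟨z, hzZ, fun y hy => le_trans ?_ (hmin (subset_closure hy))⟩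
      simp only [g, sub_self, inner_zero_right]
      linarith
  obtain ⟨x, hxZ, hx⟩ := key
  refine ⟨x, hxZ, ?_⟩
  have hgconv : ConvexOn ℝ Ω g := by
    refine ⟨hu.1, fun a ha b hb s t hs ht hst => ?_⟩
    have := hu.2 ha hb hs ht hst
    have h2 : s • a + t • b - z = s • (a - z) + t • (b - z) := by
      have : z = (s + t) • z := by rw [hst, one_smul]
      rw [smul_sub, smul_sub]
      nth_rewrite 1 [this]
      module
    simp only [g, h2, inner_add_right, real_inner_smul_right, smul_eq_mul] at this ⊢
    linarith
  have hloc : IsLocalMinOn g Ω x :=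
    Filter.mem_of_superset (mem_nhdsWithin_of_mem_nhds (hZo.mem_nhds hxZ)) (fun y hy => hx y hy)
  have := IsMinOn.of_isLocalMinOn_of_convexOn hxZ.1 hloc hgconv
  intro y hy
  have h := this hy
  simp only [mem_ofPred_eq, g] at h
  have h2 : ⟪p, y - x⟫ = ⟪p, y - z⟫ - ⟪p, x - z⟫ := by
    rw [← inner_sub_right]; congr 1; abel
  linarith

theorem aux_core {n : ℕ} {Ω : Set (EuclideanSpace ℝ (Fin n))}
    (hΩo : IsOpen Ω) {lam1 lam2 : ℝ} (hlam1 : 0 < lam1) (hlam2 : 0 < lam2)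
    {v : EuclideanSpace ℝ (Fin n) → ℝ} (hvconv : ConvexOn ℝ Ω v)
    (hma : ∀ ω : Set (EuclideanSpace ℝ (Fin n)), MeasurableSet ω → ω ⊆ Ω →
      ENNReal.ofReal lam1 * μH[(n : ℝ)] ω ≤ maMeasure Ω v ω ∧
        maMeasure Ω v ω ≤ ENNReal.ofReal lam2 * μH[(n : ℝ)] ω)
    {u : EuclideanSpace ℝ (Fin n) → ℝ} {g : EuclideanSpace ℝ (Fin n)} {c : ℝ}
    (hu : ∀ y, u y = v y - ⟪g, y⟫ - c)
    {B : Set (EuclideanSpace ℝ (Fin n))} (hB : IsCompact B) (hBΩ : B ⊆ Ω)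
    (hZB : {y ∈ Ω | u y < 0} ⊆ B) {z w E : EuclideanSpace ℝ (Fin n)}
    (hz : z ∈ Ω) (hz0 : u z < 0) (hw : w ∈ Ω) (hw0 : u w < 0)
    (hm : ∀ y ∈ Ω, u y < 0 → 2 * u z ≤ u y)
    (hE : ∀ y ∈ Ω, u y < 0 → ⟪E, y - z⟫ ≤ 1) {N : ℕ}
    (hN : ⟪E, w - z⟫ < - (6 * N : ℝ)) : N * lam1 ≤ 32 ^ n * lam2 := by
  have hhaar : (μH[(n : ℝ)] : Measure (EuclideanSpace ℝ (Fin n))).IsAddHaarMeasure := by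
    simpa using MeasureTheory.isAddHaarMeasure_hausdorffMeasure (E := EuclideanSpace ℝ (Fin n))
  set μ := (μH[(n : ℝ)] : Measure (EuclideanSpace ℝ (Fin n))) with hμ
  have huconv : ConvexOn ℝ Ω u := by
    refine ⟨hvconv.1, fun a ha b hb s t hs ht hst => ?_⟩
    have := hvconv.2 ha hb hs ht hst
    simp only [hu, inner_add_right, real_inner_smul_right, smul_eq_mul] at this ⊢
    have h2 : c = s * c + t * c := by rw [← add_mul, hst, one_mul]
    linarith
  have huc : ContinuousOn u Ω := huconv.continuousOn hΩo
  have hsubg : ∀ x p, p ∈ subgrad Ω u x → g + p ∈ subgrad Ω v x := by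
    intro x p hp y hy
    have := hp y hy
    rw [hu, hu] at this
    rw [inner_add_left, inner_sub_right g]
    linarith
  have hsubg' : ∀ x p, p ∈ subgrad Ω v x → p - g ∈ subgrad Ω u x := by
    intro x p hp y hy
    have := hp y hy
    rw [hu, hu, inner_sub_left, inner_sub_right g]
    linarith
  set Z := {y ∈ Ω | u y < 0} with hZ
  have hZo : IsOpen Z := huc.isOpen_inter_preimage hΩo isOpen_Iio
  have hZc : Convex ℝ Z := huconv.convex_lt 0
  have hzZ : z ∈ Z := ⟨hz, hz0⟩
  have hwZ : w ∈ Z := ⟨hw, hw0⟩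
  have hZΩ : Z ⊆ Ω := fun y hy => hy.1
  set h : ℝ := - u z with hh
  have hh0 : 0 < h := by linarith
  let P : Set (EuclideanSpace ℝ (Fin n)) := {p | ∀ y ∈ Z, ⟪p, y - z⟫ ≤ 1}
  have hPeq : P = ⋂ y ∈ Z, {p | ⟪p, y - z⟫ ≤ 1} := by ext; simp [P]
  have hPcl : IsClosed P := by
    rw [hPeq]
    exact isClosed_biInter fun y _ => isClosed_le (by fun_prop) continuous_const
  have hPconv : Convex ℝ P := by
    intro a ha b hb s t hs ht hst y hy
    have h1 := ha y hy
    have h2 := hb y hy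
    rw [inner_add_left, real_inner_smul_left, real_inner_smul_left]
    nlinarith
  -- P has finite positive measure
  have hPfin : μ P ≠ ⊤ := by
    obtain ⟨ρ, hρ, hball⟩ := Metric.isOpen_iff.1 hZo z hzZ
    have : P ⊆ Metric.closedBall 0 (2 / ρ) := by
      intro p hp
      rw [mem_closedBall_zero_iff]
      by_cases hp0 : p = 0
      · rw [hp0, norm_zero]; positivity
      have hpn : 0 < ‖p‖ := norm_pos_iff.2 hp0
      have := hp (z + (ρ / 2 / ‖p‖) • p) (hball (by
        rw [Metric.mem_ball, dist_eq_norm, add_sub_cancel_left, norm_smul, Real.norm_eq_abs,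
          abs_of_pos (by positivity), div_mul_cancel₀ _ hpn.ne']
        linarith))
      rw [add_sub_cancel_left, real_inner_smul_right, real_inner_self_eq_norm_sq] at this
      rw [le_div_iff₀ hρ]
      have h2 : ρ / 2 / ‖p‖ * ‖p‖ ^ 2 = ρ / 2 * ‖p‖ := by field_simp
      rw [h2] at this
      linarith
    exact ((measure_mono this).trans_lt (isCompact_closedBall _ _).measure_lt_top).ne
  have hPpos : μ P ≠ 0 := by
    obtain ⟨R, hR⟩ := hB.isBounded.subset_closedBall z
    have hR1 : 0 < |R| + 1 := by positivity
    have : Metric.ball 0 (1 / (|R| + 1)) ⊆ P := by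
      intro p hp y hy
      rw [mem_ball_zero_iff] at hp
      have h1 := hR (hZB hy)
      rw [Metric.mem_closedBall, dist_eq_norm] at h1
      calc ⟪p, y - z⟫ ≤ ‖p‖ * ‖y - z‖ := real_inner_le_norm _ _
        _ ≤ 1 / (|R| + 1) * (|R| + 1) := by
            gcongr
            linarith [le_abs_self R]
        _ = 1 := by field_simp
    exact (lt_of_lt_of_le (Metric.measure_ball_pos μ _ (by positivity)) (measure_mono this)).ne'
  have hEP : E ∈ P := fun y hy => hE y hy.1 hy.2
  have hvol := aux_vol μ hPconv hPcl hEP (W := w - z) (fun p hp => hp w hwZ) hN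
  set A := P ∩ {p | -2 ≤ ⟪p, w - z⟫} with hA
  -- upper estimate
  have hup : ENNReal.ofReal (h ^ n) * μ P ≤ ENNReal.ofReal lam2 * μ Z := by
    refine le_trans ?_ (hma Z hZo.measurableSet hZΩ).2
    have : g +ᵥ (h • P) ⊆ ⋃ x ∈ Z, subgrad Ω v x := by
      rintro _ ⟨_, ⟨p, hp, rfl⟩, rfl⟩
      obtain ⟨x, hx, hpx⟩ := aux_sub hΩo huconv hB hBΩ hZB hz hz0 (p := h • p) (by
        intro y hy hy0
        rw [real_inner_smul_left]
        have := hp y ⟨hy, hy0⟩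
        nlinarith)
      exact mem_biUnion hx (hsubg _ _ hpx)
    calc ENNReal.ofReal (h ^ n) * μ P = μ (g +ᵥ (h • P)) := by
          rw [measure_vadd, Measure.addHaar_smul_of_nonneg _ hh0.le, finrank_euclideanSpace_fin]
      _ ≤ _ := measure_mono this
  -- lower estimate
  have hlow : ENNReal.ofReal lam1 * μ Z ≤ ENNReal.ofReal ((16 * h) ^ n) * μ A := by
    let Q := AffineMap.homothety (z + (1/3:ℝ) • (w - z)) (1/4:ℝ) '' Z
    have hQ : ∀ y, AffineMap.homothety (z + (1/3:ℝ) • (w - z)) (1/4:ℝ) y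
        = z + (1/4:ℝ) • (w - z) + (1/4:ℝ) • (y - z) := by
      intro y
      simp only [AffineMap.homothety_apply, vsub_eq_sub, vadd_eq_add]
      module
    have hQo : IsOpen Q := by
      exact AffineMap.homothety_isOpenMap _ _ (by norm_num) _ hZo
    have hQZ : Q ⊆ Z := by
      rintro _ ⟨y, hy, rfl⟩
      rw [hQ, show z + (1/4:ℝ) • (w - z) + (1/4:ℝ) • (y - z) = (1/2:ℝ) • z + (1/2:ℝ) • ((1/2:ℝ) • w + (1/2:ℝ) • y)
        by module]
      exact hZc hzZ (hZc hwZ hy (by norm_num) (by norm_num) (by norm_num)) (by norm_num)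
        (by norm_num) (by norm_num)
    have h1 := (hma Q hQo.measurableSet (hQZ.trans hZΩ)).1
    have h2 : (⋃ x ∈ Q, subgrad Ω v x) ⊆ g +ᵥ ((4 * h) • A) := by
      intro p hp
      simp only [mem_iUnion] at hp
      obtain ⟨x, hx, hpx⟩ := hp
      have hxZ := hQZ hx
      obtain ⟨y, hy, rfl⟩ := hx
      set x := AffineMap.homothety (z + (1/3:ℝ) • (w - z)) (1/4:ℝ) y with hxdef
      rw [hQ] at hxdef
      have hq := hsubg' _ _ hpx
      set q := p - g with hqdef
      have hmx := hm x hxZ.1 hxZ.2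
      have hbd : ∀ t ∈ Z, ⟪q, t - x⟫ ≤ 2 * h := by
        intro t ht
        have h3 := hq t ht.1
        have := ht.2
        linarith
      have h40 : (4 * h) ≠ 0 := by positivity
      refine ⟨q, ⟨(4 * h)⁻¹ • q, ⟨?_, ?_⟩, ?_⟩, ?_⟩
      · intro t ht
        have := hbd (x + (1/2:ℝ) • (t - z)) (by
          rw [hxdef, show z + (1/4:ℝ) • (w - z) + (1/4:ℝ) • (y - z) + (1/2:ℝ) • (t - z) =
            (1/2:ℝ) • t + (1/2:ℝ) • ((1/2:ℝ) • w + (1/2:ℝ) • y) by module]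
          exact hZc ht (hZc hwZ hy (by norm_num) (by norm_num) (by norm_num)) (by norm_num)
            (by norm_num) (by norm_num))
        rw [add_sub_cancel_left, real_inner_smul_right] at this
        rw [real_inner_smul_left, inv_mul_le_iff₀ (by positivity)]
        linarith
      · have := hbd (x - (1/4:ℝ) • (w - z)) (by
          rw [hxdef, show z + (1/4:ℝ) • (w - z) + (1/4:ℝ) • (y - z) - (1/4:ℝ) • (w - z) =
            (3/4:ℝ) • z + (1/4:ℝ) • y by module]
          exact hZc hzZ hy (by norm_num) (by norm_num) (by norm_num))
        rw [sub_sub_cancel_left, inner_neg_right, real_inner_smul_right] at this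
        simp only [mem_ofPred_eq]
        rw [real_inner_smul_left, le_inv_mul_iff₀ (by positivity)]
        linarith
      · simp only [smul_inv_smul₀ h40]
      · simp [hqdef]
    have h3 : maMeasure Ω v Q ≤ ENNReal.ofReal ((4 * h) ^ n) * μ A := by
      calc maMeasure Ω v Q ≤ μ (g +ᵥ ((4 * h) • A)) := measure_mono h2
        _ = _ := by
          rw [measure_vadd, Measure.addHaar_smul_of_nonneg _ (by positivity),
            finrank_euclideanSpace_fin]
    have h4 : μ Z = ENNReal.ofReal (4 ^ n) * μ Q := by
      rw [Measure.addHaar_image_homothety, finrank_euclideanSpace_fin, ← mul_assoc,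
        ← ENNReal.ofReal_mul (by positivity), abs_of_nonneg (by positivity), ← mul_pow]
      norm_num
    calc ENNReal.ofReal lam1 * μ Z = ENNReal.ofReal (4 ^ n) * (ENNReal.ofReal lam1 * μ Q) := by
          rw [h4]; ring
      _ ≤ ENNReal.ofReal (4 ^ n) * (ENNReal.ofReal ((4 * h) ^ n) * μ A) := by
          exact mul_le_mul' le_rfl (h1.trans h3)
      _ = _ := by
          rw [← mul_assoc, ← ENNReal.ofReal_mul (by positivity), ← mul_pow]
          congr 3; ring
  -- combine
  have hfin : ENNReal.ofReal (N * lam1 * h ^ n) * μ P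
      ≤ ENNReal.ofReal (32 ^ n * lam2 * h ^ n) * μ P := by
    have e1 : ENNReal.ofReal (N * lam1 * h ^ n) = N * ENNReal.ofReal lam1 * ENNReal.ofReal (h ^ n) := by
      rw [ENNReal.ofReal_mul (by positivity), ENNReal.ofReal_mul (by positivity),
        ENNReal.ofReal_natCast]
    have e2 : ENNReal.ofReal (32 ^ n * lam2 * h ^ n) =
        2 ^ n * ENNReal.ofReal lam2 * ENNReal.ofReal ((16 * h) ^ n) := by
      rw [show (2:ℝ≥0∞) = ENNReal.ofReal 2 by simp,
        ← ENNReal.ofReal_pow (by norm_num), ← ENNReal.ofReal_mul (by positivity),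
        ← ENNReal.ofReal_mul (by positivity)]
      congr 1
      rw [mul_pow, show (32:ℝ) = 2 * 16 by norm_num, mul_pow]; ring
    rw [e1, e2]
    calc N * ENNReal.ofReal lam1 * ENNReal.ofReal (h ^ n) * μ P
        = N * ENNReal.ofReal lam1 * (ENNReal.ofReal (h ^ n) * μ P) := by ring
      _ ≤ N * ENNReal.ofReal lam1 * (ENNReal.ofReal lam2 * μ Z) := by gcongr
      _ = N * ENNReal.ofReal lam2 * (ENNReal.ofReal lam1 * μ Z) := by ring
      _ ≤ N * ENNReal.ofReal lam2 * (ENNReal.ofReal ((16 * h) ^ n) * μ A) := by gcongr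
      _ = ENNReal.ofReal lam2 * ENNReal.ofReal ((16 * h) ^ n) * (N * μ A) := by ring
      _ ≤ ENNReal.ofReal lam2 * ENNReal.ofReal ((16 * h) ^ n) * (2 ^ n * μ P) := by gcongr
      _ = _ := by ring
  rw [ENNReal.mul_le_mul_iff_left hPpos hPfin, ENNReal.ofReal_le_ofReal_iff (by positivity)] at hfin
  exact le_of_mul_le_mul_right hfin (by positivity)

end


/-- **Theorem 3.6 (i) (Caffarelli).** If `λ₁ ≤ det ∇²v ≤ λ₂` in the sense of measure
for a nonnegative convex `v` on the open convex set `Ω`, and the zero set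
`S = {v = 0}` is not a point, then `S` has no extremal point in `Ω`. -/
theorem stmt18 {n : ℕ} (hn : 1 ≤ n) {Ω : Set (EuclideanSpace ℝ (Fin n))}
    (hΩo : IsOpen Ω) (hΩc : Convex ℝ Ω) {lam1 lam2 : ℝ} (hlam1 : 0 < lam1) (hlam12 : lam1 < lam2)
    {v : EuclideanSpace ℝ (Fin n) → ℝ} (hvconv : ConvexOn ℝ Ω v)
    (hvnonneg : ∀ x ∈ Ω, 0 ≤ v x)
    (hma : ∀ ω : Set (EuclideanSpace ℝ (Fin n)), MeasurableSet ω → ω ⊆ Ω →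
      ENNReal.ofReal lam1 * μH[(n : ℝ)] ω ≤ maMeasure Ω v ω ∧
        maMeasure Ω v ω ≤ ENNReal.ofReal lam2 * μH[(n : ℝ)] ω)
    (S : Set (EuclideanSpace ℝ (Fin n))) (hS : S = {x ∈ Ω | v x = 0})
    (hStwo : ∃ x ∈ S, ∃ y ∈ S, x ≠ y) :
    ∀ z ∈ S, ∃ x₁ ∈ S, ∃ x₂ ∈ S, ∃ α : ℝ, α ∈ Set.Ioo (0 : ℝ) 1 ∧
      z = α • x₁ + (1 - α) • x₂ ∧ ¬ (x₁ = z ∧ x₂ = z) := by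
  intro z hzS
  by_contra hcon
  have hlam2 : 0 < lam2 := hlam1.trans hlam12
  have hvc : ContinuousOn v Ω := hvconv.continuousOn hΩo
  have hSΩ : S ⊆ Ω := by rw [hS]; exact fun x hx => hx.1
  have hSv : ∀ x ∈ S, v x = 0 := by rw [hS]; exact fun x hx => hx.2
  have hSc : Convex ℝ S := by
    have : S = {x ∈ Ω | v x ≤ 0} := by
      rw [hS]; ext x
      exact ⟨fun h => ⟨h.1, h.2.le⟩, fun h => ⟨h.1, le_antisymm h.2 (hvnonneg x h.1)⟩⟩
    rw [this]
    exact hvconv.convex_le 0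
  have hext : z ∈ S.extremePoints ℝ := by
    rw [mem_extremePoints]
    refine ⟨hzS, ?_⟩
    rintro x₁ hx₁ x₂ hx₂ ⟨a, b, ha, hb, hab, rfl⟩
    by_contra hne
    refine hcon ⟨x₁, hx₁, x₂, hx₂, a, ⟨ha, by linarith⟩, ?_, hne⟩
    rw [show 1 - a = b by linarith]
  obtain ⟨y0, hy0S, hy0⟩ : ∃ y ∈ S, y ≠ z := by
    obtain ⟨x, hx, y, hy, hxy⟩ := hStwo
    by_cases h : x = z
    · exact ⟨y, hy, fun h' => hxy (h.trans h'.symm)⟩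
    · exact ⟨x, hx, h⟩
  have hd0 : 0 < ‖y0 - z‖ := norm_pos_iff.2 (sub_ne_zero.2 hy0)
  obtain ⟨r1, hr1, hball1⟩ := Metric.isOpen_iff.1 hΩo z (hSΩ hzS)
  obtain ⟨r, hr, hrd, hB⟩ : ∃ r : ℝ, 0 < r ∧ r < ‖y0 - z‖ ∧ Metric.closedBall z r ⊆ Ω := by
    refine ⟨min r1 ‖y0 - z‖ / 2, by positivity, ?_, ?_⟩
    · have := min_le_right r1 ‖y0 - z‖; linarith
    · refine (Metric.closedBall_subset_ball ?_).trans hball1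
      have := min_le_left r1 ‖y0 - z‖; linarith
  set B := Metric.closedBall z r with hBdef
  have hBc : IsCompact B := isCompact_closedBall _ _
  have hzB : z ∈ B := Metric.mem_closedBall_self hr.le
  have hBconv : Convex ℝ B := convex_closedBall _ _
  set K := S ∩ B with hKdef
  have hKeq : K = B ∩ v ⁻¹' {0} := by
    ext x
    constructor
    · rintro ⟨h1, h2⟩; exact ⟨h2, hSv x h1⟩
    · rintro ⟨h1, h2⟩
      refine ⟨?_, h1⟩
      rw [hS]; exact ⟨hB h1, h2⟩
  have hKcl : IsClosed K := by
    rw [hKeq]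
    exact (hvc.mono hB).preimage_isClosed_of_isClosed hBc.isClosed isClosed_singleton
  have hKc : IsCompact K := hBc.of_isClosed_subset hKcl inter_subset_right
  have hKconv : Convex ℝ K := hSc.inter hBconv
  have hzK : z ∈ K := ⟨hzS, hzB⟩
  have hKext : z ∈ K.extremePoints ℝ :=
    inter_extremePoints_subset_extremePoints_of_subset inter_subset_left ⟨hzK, hext⟩
  obtain ⟨e, c, hcz, hcap⟩ := aux_cap hKconv hKc hKext hr
  -- the point on the sphere
  obtain ⟨k, hkK, hkc⟩ : ∃ k ∈ K, ⟪e, k⟫ < c := by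
    have ht1 : r / ‖y0 - z‖ < 1 := by rwa [div_lt_one hd0]
    have hdist : dist (z + (r / ‖y0 - z‖) • (y0 - z)) z = r := by
      rw [dist_eq_norm, add_sub_cancel_left, norm_smul, Real.norm_eq_abs,
        abs_of_pos (by positivity), div_mul_cancel₀ _ hd0.ne']
    have hkK : z + (r / ‖y0 - z‖) • (y0 - z) ∈ K := by
      refine ⟨?_, ?_⟩
      · exact hSc.add_smul_sub_mem hzS hy0S ⟨by positivity, ht1.le⟩
      · rw [hBdef, Metric.mem_closedBall, hdist]
    refine ⟨_, hkK, ?_⟩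
    by_contra h
    have := hcap _ hkK (not_lt.1 h)
    linarith
  obtain ⟨z', hz'K, hz'max⟩ := hKc.exists_isMaxOn ⟨z, hzK⟩
    (f := fun y => ⟪e, y⟫) (by fun_prop)
  have hz'max : ∀ y ∈ K, ⟪e, y⟫ ≤ ⟪e, z'⟫ := fun y hy => hz'max hy
  obtain ⟨w, hwK, hw1, hw2⟩ : ∃ w ∈ K, c < ⟪e, w⟫ ∧ ⟪e, w⟫ < ⟪e, z⟫ := by
    set a := ⟪e, z⟫ - c with ha
    set b := ⟪e, z⟫ - ⟪e, k⟫ with hb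
    have ha0 : 0 < a := by linarith
    have hab : a < b := by linarith
    have hb0 : 0 < b := by linarith
    have ht : a / 2 / b * b = a / 2 := div_mul_cancel₀ _ hb0.ne'
    refine ⟨z + (a / 2 / b) • (k - z), hKconv.add_smul_sub_mem hzK hkK ⟨by positivity, ?_⟩, ?_, ?_⟩
    · rw [div_le_one hb0]; linarith
    · rw [inner_add_right, real_inner_smul_right, inner_sub_right]
      nlinarith
    · rw [inner_add_right, real_inner_smul_right, inner_sub_right]
      nlinarith
  have hzz' := hz'max z hzK
  set L := ⟪e, z'⟫ - c with hL
  have hL0 : 0 < L := by linarith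
  set d := ⟪e, z'⟫ - ⟪e, w⟫ with hd
  have hdpos : 0 < d := by linarith
  obtain ⟨N, hN⟩ := exists_nat_gt (32 ^ n * lam2 / lam1)
  rw [div_lt_iff₀ hlam1] at hN
  set η := min L (d / (6 * N + 1)) with hη
  have hη0 : 0 < η := lt_min hL0 (by positivity)
  have hηL : η ≤ L := min_le_left _ _
  have hηd : (6 * N + 1) * η ≤ d := by
    have : η ≤ d / (6 * N + 1) := min_le_right _ _
    rw [le_div_iff₀ (by positivity)] at this
    linarith
  let D : Set (EuclideanSpace ℝ (Fin n)) :=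
    (Metric.sphere z r ∩ {y | c ≤ ⟪e, y⟫}) ∪ (B ∩ {y | c + L + η ≤ ⟪e, y⟫})
  have hDB : D ⊆ B := by
    rintro y (⟨hy, -⟩ | ⟨hy, -⟩)
    · exact Metric.sphere_subset_closedBall hy
    · exact hy
  have hDcl : IsClosed D :=
    (Metric.isClosed_sphere.inter (isClosed_le continuous_const (by fun_prop))).union
      (hBc.isClosed.inter (isClosed_le continuous_const (by fun_prop)))
  have hDc : IsCompact D := hBc.of_isClosed_subset hDcl hDB
  have hDpos : ∀ y ∈ D, 0 < v y := by
    intro y hy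
    refine lt_of_le_of_ne (hvnonneg y (hB (hDB hy))) fun h0 => ?_
    have hyK : y ∈ K := by rw [hKeq]; exact ⟨hDB hy, h0.symm⟩
    rcases hy with ⟨h1, h2⟩ | ⟨h1, h2⟩
    · have h3 := hcap y hyK h2
      rw [Metric.mem_sphere] at h1
      linarith
    · have h3 := hz'max y hyK
      simp only [mem_ofPred_eq] at h2
      linarith
  obtain ⟨c0, hc0, hc0D⟩ : ∃ c0 : ℝ, 0 < c0 ∧ ∀ y ∈ D, c0 ≤ v y := by
    rcases D.eq_empty_or_nonempty with hDe | hDn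
    · exact ⟨1, one_pos, by simp [hDe]⟩
    · obtain ⟨x, hx, hmin⟩ := hDc.exists_isMinOn hDn (hvc.mono (hDB.trans hB))
      exact ⟨v x, hDpos x hx, fun y hy => hmin hy⟩
  obtain ⟨M, hM0, hM⟩ : ∃ M : ℝ, 0 < M ∧ ∀ y ∈ B, ⟪e, y⟫ - c ≤ M := by
    obtain ⟨x, hx, hmax⟩ := hBc.exists_isMaxOn ⟨z, hzB⟩ (f := fun y => ⟪e, y⟫ - c) (by fun_prop)
    have hmax : ∀ y ∈ B, ⟪e, y⟫ - c ≤ ⟪e, x⟫ - c := fun y hy => hmax hy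
    exact ⟨⟪e, x⟫ - c, by linarith [hmax z hzB], hmax⟩
  set ε := c0 / (2 * M) with hε
  have hε0 : 0 < ε := by positivity
  have hεM : ε * M < c0 := by
    rw [hε, show c0 / (2 * M) * M = c0 / 2 by field_simp]; linarith
  let u : EuclideanSpace ℝ (Fin n) → ℝ := fun y => v y - ⟪ε • e, y⟫ - (-(ε * c))
  have hu : ∀ y, u y = v y - ε * (⟪e, y⟫ - c) := by
    intro y; simp only [u, real_inner_smul_left]; ring
  have huD : ∀ y ∈ D, 0 < u y := by
    intro y hy
    rw [hu]
    have h1 := hc0D y hy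
    have h2 := mul_le_mul_of_nonneg_left (hM y (hDB hy)) hε0.le
    linarith
  have huconv : ConvexOn ℝ Ω u := by
    refine ⟨hΩc, fun a ha b hb s t hs ht hst => ?_⟩
    have := hvconv.2 ha hb hs ht hst
    simp only [u, inner_add_right, real_inner_smul_right, smul_eq_mul] at this ⊢
    have h2 : ε * c = s * (ε * c) + t * (ε * c) := by rw [← add_mul, hst, one_mul]
    linarith
  have huK : ∀ y ∈ K, c < ⟪e, y⟫ → u y < 0 := by
    intro y hy hcy
    rw [hu, hSv y hy.1]
    have := mul_pos hε0 (sub_pos.2 hcy)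
    linarith
  have hZB : {y ∈ Ω | u y < 0} ⊆ B := by
    intro y hy
    by_contra hyB
    have hyr : r < ‖y - z‖ := by
      rw [hBdef, Metric.mem_closedBall, dist_eq_norm] at hyB
      exact not_le.1 hyB
    have hy0 : 0 < ‖y - z‖ := hr.trans hyr
    have hdist : dist (z + (r / ‖y - z‖) • (y - z)) z = r := by
      rw [dist_eq_norm, add_sub_cancel_left, norm_smul, Real.norm_eq_abs,
        abs_of_pos (by positivity), div_mul_cancel₀ _ hy0.ne']
    have hs := (huconv.convex_lt 0).add_smul_sub_mem (x := z) ⟨hSΩ hzS, huK z hzK hcz⟩ hy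
      (t := r / ‖y - z‖) ⟨by positivity, by rw [div_le_one hy0]; exact hyr.le⟩
    set s := z + (r / ‖y - z‖) • (y - z)
    have hs2 := hs.2
    by_cases hcs : c ≤ ⟪e, s⟫
    · have := huD s (Or.inl ⟨hdist, hcs⟩)
      linarith
    · rw [hu] at hs2
      have h1 := hvnonneg s hs.1
      have := mul_pos hε0 (sub_pos.2 (not_le.1 hcs))
      linarith
  have hZl : ∀ y ∈ Ω, u y < 0 → ⟪e, y⟫ < c + L + η := by
    intro y hy hy0
    by_contra h
    have := huD y (Or.inr ⟨hZB ⟨hy, hy0⟩, not_lt.1 h⟩)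
    linarith
  have hfinal := aux_core hΩo hlam1 hlam2 hvconv hma (u := u) (g := ε • e) (c := -(ε * c))
    (fun y => rfl) hBc hB hZB (z := z') (w := w) (E := η⁻¹ • e) (hSΩ hz'K.1)
    (huK z' hz'K (by linarith)) (hSΩ hwK.1) (huK w hwK hw1)
    (by
      intro y hy hy0
      rw [hu, hu, hSv z' hz'K.1]
      have h1 := hZl y hy hy0
      have h2 := hvnonneg y hy
      have h3 : ε * (⟪e, y⟫ - c) ≤ ε * (2 * L) := mul_le_mul_of_nonneg_left (by linarith) hε0.le
      rw [← hL]
      linarith)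
    (by
      intro y hy hy0
      have h1 := hZl y hy hy0
      rw [real_inner_smul_left, inner_sub_right, inv_mul_le_iff₀ hη0]
      linarith)
    (N := N)
    (by
      rw [real_inner_smul_left, inner_sub_right, inv_mul_lt_iff₀ hη0]
      nlinarith)
  linarith
end
end

section
/- Let n ≥ 1, let Ω ⊆ ℝ^n be an open convex set, let 0 < λ1 < λ2, and let v be a convex function on Ω that is strictly convex on Ω and satisfies λ1·H^n(ω) ≤ μ_v(ω) ≤ λ2·H^n(ω) for every Borel set ω ⊆ Ω. Then v is differentiable at every point of Ω (hence, being convex, v is C¹ on Ω). -/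
open MeasureTheory Set
open scoped ENNReal NNReal RealInnerProductSpace

noncomputable section

lemma aux_exists_subgrad {n : ℕ} {Ω : Set (EuclideanSpace ℝ (Fin n))}
    (hΩo : IsOpen Ω) {v : EuclideanSpace ℝ (Fin n) → ℝ} (hv : ConvexOn ℝ Ω v)
    (hvc : ContinuousOn v Ω) {x0 : EuclideanSpace ℝ (Fin n)} (hx0 : x0 ∈ Ω)
    (e : EuclideanSpace ℝ (Fin n)) (L : ℝ)
    (h : ∀ s : ℝ, x0 + s • e ∈ Ω → v x0 + L * s ≤ v (x0 + s • e)) :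
    ∃ p ∈ subgrad Ω v x0, ⟪p, e⟫ = L := by
  have hAc := hv.convex_strict_epigraph
  have hAo : IsOpen {p : EuclideanSpace ℝ (Fin n) × ℝ | p.1 ∈ Ω ∧ v p.1 < p.2} := by
    have h1 : ContinuousOn (fun p : EuclideanSpace ℝ (Fin n) × ℝ => p.2 - v p.1) (Ω ×ˢ univ) := by
      apply ContinuousOn.sub continuous_snd.continuousOn
      exact hvc.comp continuous_fst.continuousOn (fun p hp => hp.1)
    have h2 := h1.isOpen_inter_preimage (hΩo.prod isOpen_univ) (isOpen_Ioi (a := (0:ℝ)))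
    convert h2 using 1
    ext p
    simp
  have hBc : Convex ℝ (range fun s : ℝ => (x0 + s • e, v x0 + L * s)) := by
    rintro _ ⟨s, rfl⟩ _ ⟨s', rfl⟩ a b ha hb hab
    refine ⟨a * s + b * s', ?_⟩
    obtain rfl : b = 1 - a := by linarith
    ext1
    · simp only [Prod.fst_add, Prod.smul_fst]
      module
    · simp
      ring
  have hd : Disjoint {p : EuclideanSpace ℝ (Fin n) × ℝ | p.1 ∈ Ω ∧ v p.1 < p.2}
      (range fun s : ℝ => (x0 + s • e, v x0 + L * s)) := by
    rw [Set.disjoint_left]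
    rintro _ ⟨h1, h2⟩ ⟨s, rfl⟩
    exact absurd (h s h1) (not_le.2 h2)
  obtain ⟨f, u, hfA, hfB⟩ := geometric_hahn_banach_open hAc hAo hBc hd
  set g := f.comp (ContinuousLinearMap.inl ℝ _ ℝ) with hg
  set c := f (0, 1) with hc
  have hf : ∀ x r, f (x, r) = g x + c * r := by
    intro x r
    have : (x, r) = (x, (0:ℝ)) + r • ((0 : EuclideanSpace ℝ (Fin n)), (1:ℝ)) := by simp
    rw [this, map_add, map_smul]
    simp [hg, hc, mul_comm]
  have hB : ∀ s : ℝ, u ≤ g x0 + s * g e + c * (v x0 + L * s) := by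
    intro s
    have := hfB _ ⟨s, rfl⟩
    simpa [hf] using this
  have hA : ∀ y ∈ Ω, ∀ r, v y < r → g y + c * r < u := by
    intro y hy r hr
    have := hfA (y, r) ⟨hy, hr⟩
    simpa [hf] using this
  have hc0 : c < 0 := by
    have h1 := hA x0 hx0 (v x0 + 1) (by linarith)
    have h2 := hB 0
    simp at h2
    linarith
  have hge : g e + c * L = 0 := by
    by_contra hne
    have h2 := hB ((u - 1 - g x0 - c * v x0) / (g e + c * L))
    have h3 : (u - 1 - g x0 - c * v x0) / (g e + c * L) * (g e + c * L) =
      (u - 1 - g x0 - c * v x0) := div_mul_cancel₀ _ hne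
    nlinarith
  refine ⟨(InnerProductSpace.toDual ℝ _).symm ((-1 / c) • g), ?_, ?_⟩
  · intro y hy
    rw [InnerProductSpace.toDual_symm_apply]
    have h1 : g y + c * v y ≤ g x0 + c * v x0 := by
      apply le_of_forall_pos_lt_add
      intro ε hε
      have h2 := hA y hy (v y + ε / (-c)) (by have := div_pos hε (neg_pos.2 hc0); linarith)
      have h3 := hB 0
      have h4 : c * (ε / (-c)) = - ε := by
        have := hc0.ne
        field_simp
      simp at h3
      linarith
    have h5 : ((-1 / c) • g) (y - x0) = -(g y - g x0) / c := by
      simp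
      ring
    rw [h5, ← le_sub_iff_add_le', div_le_iff_of_neg hc0]
    linarith
  · rw [InnerProductSpace.toDual_symm_apply]
    have : g e = - c * L := by linarith
    have hcn := hc0.ne
    rw [smul_apply, this, smul_eq_mul]
    field_simp

lemma aux_diff {n : ℕ} (hn : 1 ≤ n) {Ω : Set (EuclideanSpace ℝ (Fin n))}
    (hΩo : IsOpen Ω) {v : EuclideanSpace ℝ (Fin n) → ℝ} (hv : ConvexOn ℝ Ω v)
    (hvc : ContinuousOn v Ω) {x0 : EuclideanSpace ℝ (Fin n)} (hx0 : x0 ∈ Ω)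
    (hd : ∀ i, DifferentiableAt ℝ (fun s : ℝ => v (x0 + s • EuclideanSpace.single i (1:ℝ))) 0) :
    DifferentiableAt ℝ v x0 := by
  obtain ⟨p, hp, -⟩ := aux_exists_subgrad hΩo hv hvc hx0 0 0 (by simp)
  have hnpos : (0:ℝ) < n := by exact_mod_cast hn
  set r : EuclideanSpace ℝ (Fin n) → ℝ := fun h => v (x0 + h) - v x0 - ⟪p, h⟫ with hr
  have hr0 : ∀ h, x0 + h ∈ Ω → 0 ≤ r h := by
    intro h hh
    have := hp _ hh
    simp at this
    simp only [hr]
    linarith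
  have hcts : ∀ (e : EuclideanSpace ℝ (Fin n)), Continuous fun s : ℝ => x0 + s • e := by
    intro e; fun_prop
  have hderiv : ∀ i, HasDerivAt (fun s : ℝ => r (s • EuclideanSpace.single i (1:ℝ))) 0 0 := by
    intro i
    have h1 : HasDerivAt (fun s : ℝ => r (s • EuclideanSpace.single i (1:ℝ)))
      (deriv (fun s : ℝ => v (x0 + s • EuclideanSpace.single i (1:ℝ))) 0 - p i) 0 := by
      have h2 := ((hd i).hasDerivAt.sub_const (v x0)).sub ((hasDerivAt_id (0:ℝ)).mul_const (p i))
      simp only [one_mul] at h2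
      refine h2.congr_of_eventuallyEq (Filter.Eventually.of_forall fun s => ?_)
      simp [hr, inner_smul_right, EuclideanSpace.inner_single_right]
    have h3 : IsLocalMin (fun s : ℝ => r (s • EuclideanSpace.single i (1:ℝ))) 0 := by
      have : ∀ᶠ s in nhds (0:ℝ), x0 + s • EuclideanSpace.single i (1:ℝ) ∈ Ω :=
        (hcts _).continuousAt.eventually_mem (by simpa using hΩo.mem_nhds hx0)
      filter_upwards [this] with s hs
      have := hr0 _ hs
      simpa [hr] using this
    have h4 := h3.hasDerivAt_eq_zero h1
    rwa [h4] at h1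
  have hr00 : r 0 = 0 := by simp [hr]
  have key : HasFDerivAt v (innerSL ℝ p) x0 := by
    rw [hasFDerivAt_iff_isLittleO_nhds_zero, Asymptotics.isLittleO_iff]
    intro ε hε
    have h1 : ∀ i, ∀ᶠ s in nhds (0:ℝ), x0 + s • EuclideanSpace.single i (1:ℝ) ∈ Ω ∧
        r (s • EuclideanSpace.single i (1:ℝ)) ≤ (ε / n) * |s| := by
      intro i
      have a1 : ∀ᶠ s in nhds (0:ℝ), x0 + s • EuclideanSpace.single i (1:ℝ) ∈ Ω :=
        (hcts _).continuousAt.eventually_mem (by simpa using hΩo.mem_nhds hx0)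
      have a2 := hderiv i
      rw [hasDerivAt_iff_isLittleO_nhds_zero, Asymptotics.isLittleO_iff] at a2
      have a3 := a2 (div_pos hε hnpos)
      filter_upwards [a1, a3] with s hs hs'
      refine ⟨hs, ?_⟩
      simp [hr00] at hs'
      exact (le_abs_self _).trans hs'
    have h2 : ∀ᶠ h : EuclideanSpace ℝ (Fin n) in nhds 0, ∀ i,
        x0 + ((n:ℝ) * h i) • EuclideanSpace.single i (1:ℝ) ∈ Ω ∧
        r (((n:ℝ) * h i) • EuclideanSpace.single i (1:ℝ)) ≤ (ε / n) * |(n:ℝ) * h i| := by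
      rw [Filter.eventually_all]
      intro i
      have : Filter.Tendsto (fun h : EuclideanSpace ℝ (Fin n) => (n:ℝ) * h i) (nhds 0) (nhds 0) := by
        have : Continuous (fun h : EuclideanSpace ℝ (Fin n) => (n:ℝ) * h i) := by fun_prop
        simpa using this.tendsto 0
      exact this.eventually (h1 i)
    have h3 : ∀ᶠ h : EuclideanSpace ℝ (Fin n) in nhds 0, x0 + h ∈ Ω := by
      have : Continuous (fun h : EuclideanSpace ℝ (Fin n) => x0 + h) := by fun_prop
      exact this.continuousAt.eventually_mem (by simpa using hΩo.mem_nhds hx0)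
    filter_upwards [h2, h3] with h hh2 hh3
    have e1 : v (x0 + h) - v x0 - (innerSL ℝ p) h = r h := by simp [hr]
    rw [e1, Real.norm_of_nonneg (hr0 _ hh3)]
    have e2 : ∑ i : Fin n, (1/(n:ℝ)) • (x0 + ((n:ℝ) * h i) • EuclideanSpace.single i (1:ℝ)) = x0 + h := by
      simp only [smul_add, Finset.sum_add_distrib]
      congr 1
      · simp [← Nat.cast_smul_eq_nsmul ℝ, smul_smul, hnpos.ne']
      · ext j
        simp [Finset.sum_apply, hnpos.ne', Pi.single_apply]
    have hsum1 : ∑ i : Fin n, (1/(n:ℝ)) = 1 := by simp [hnpos.ne']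
    have e3 := hv.map_sum_le (t := Finset.univ) (w := fun _ => 1/(n:ℝ))
      (p := fun i : Fin n => x0 + ((n:ℝ) * h i) • EuclideanSpace.single i (1:ℝ))
      (fun i _ => by positivity) hsum1 (fun i _ => (hh2 i).1)
    rw [e2] at e3
    have e4 : ⟪p, h⟫ = ∑ i : Fin n, (1/(n:ℝ)) * ⟪p, ((n:ℝ) * h i) • EuclideanSpace.single i (1:ℝ)⟫ := by
      simp only [inner_smul_right, EuclideanSpace.inner_single_right]
      rw [PiLp.inner_apply]
      apply Finset.sum_congr rfl
      intro i _
      simp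
      field_simp
    have e5 : r h ≤ ∑ i : Fin n, (1/(n:ℝ)) * r (((n:ℝ) * h i) • EuclideanSpace.single i (1:ℝ)) := by
      simp only [hr, mul_sub, Finset.sum_sub_distrib]
      rw [← e4, ← Finset.sum_mul, hsum1]
      simpa using e3
    refine e5.trans ?_
    calc _ ≤ ∑ i : Fin n, (1/(n:ℝ)) * (ε * ‖h‖) := by
            apply Finset.sum_le_sum
            intro i _
            apply mul_le_mul_of_nonneg_left _ (by positivity)
            refine (hh2 i).2.trans ?_
            rw [abs_mul, abs_of_pos hnpos]
            have : |h i| ≤ ‖h‖ := PiLp.norm_apply_le h i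
            calc ε / n * (n * |h i|) = ε * |h i| := by field_simp
              _ ≤ _ := by gcongr
      _ = _ := by rw [← Finset.sum_mul, hsum1, one_mul]
  exact key.differentiableAt

/-- non-differentiable: two subgradients. -/
lemma aux_nondiff {n : ℕ} (hn : 1 ≤ n) {Ω : Set (EuclideanSpace ℝ (Fin n))}
    (hΩo : IsOpen Ω) {v : EuclideanSpace ℝ (Fin n) → ℝ} (hv : ConvexOn ℝ Ω v)
    (hvc : ContinuousOn v Ω) {x0 : EuclideanSpace ℝ (Fin n)} (hx0 : x0 ∈ Ω)
    (hnd : ¬ DifferentiableAt ℝ v x0) :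
    ∃ p ∈ subgrad Ω v x0, ∃ p' ∈ subgrad Ω v x0, ∃ e : EuclideanSpace ℝ (Fin n),
      ⟪p' - p, e⟫ = 1 ∧ HasDerivWithinAt (fun s : ℝ => v (x0 + s • e)) ⟪p, e⟫ (Iio 0) 0 := by
  have : ∃ i, ¬ DifferentiableAt ℝ (fun s : ℝ => v (x0 + s • EuclideanSpace.single i (1:ℝ))) 0 := by
    by_contra! hcon
    exact hnd (aux_diff hn hΩo hv hvc hx0 hcon)
  obtain ⟨i, hi⟩ := this
  set e : EuclideanSpace ℝ (Fin n) := EuclideanSpace.single i (1:ℝ) with he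
  set φ := (fun s : ℝ => v (x0 + s • e)) with hφ
  set S := (fun s : ℝ => x0 + s • e) ⁻¹' Ω with hS
  have hSo : IsOpen S := hΩo.preimage (by fun_prop)
  have h0S : (0:ℝ) ∈ S := by simpa [hS] using hx0
  have h0i : (0:ℝ) ∈ interior S := by rwa [hSo.interior_eq]
  have hcv : ConvexOn ℝ S φ := by
    have h := hv.comp_affineMap (AffineMap.lineMap x0 (x0 + e))
    have e1 : S = (AffineMap.lineMap x0 (x0 + e) : ℝ →ᵃ[ℝ] _) ⁻¹' Ω := by
      ext s; simp [hS, AffineMap.lineMap_apply, add_comm]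
    have e2 : φ = v ∘ (AffineMap.lineMap x0 (x0 + e) : ℝ →ᵃ[ℝ] _) := by
      ext s; simp [hφ, AffineMap.lineMap_apply, add_comm]
    rw [e1, e2]
    exact h
  have hL := hcv.hasDerivWithinAt_leftDeriv_of_mem_interior h0i
  have hR := hcv.hasDerivWithinAt_rightDeriv_of_mem_interior h0i
  have hLR := hcv.leftDeriv_le_rightDeriv_of_mem_interior h0i
  set l := derivWithin φ (Iio 0) 0
  set rr := derivWithin φ (Ioi 0) 0
  have hlt : l < rr := by
    rcases hLR.lt_or_eq with h | h
    · exact h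
    · exfalso
      rw [← h] at hR
      have h2 := (hL.Iic_of_Iio).union (hR.Ici_of_Ioi)
      rw [Iic_union_Ici] at h2
      exact hi (h2.hasDerivAt Filter.univ_mem).differentiableAt
  have hsl : ∀ c, l ≤ c → c ≤ rr → ∀ s : ℝ, x0 + s • e ∈ Ω → v x0 + c * s ≤ v (x0 + s • e) := by
    intro c hc1 hc2 s hs
    have hφ0 : φ 0 = v x0 := by simp [hφ]
    rcases lt_trichotomy s 0 with h | h | h
    · have := hcv.slope_le_leftDeriv_of_mem_interior hs h0i h
      rw [slope_def_field, div_le_iff₀ (by linarith), hφ0] at this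
      change v x0 - v (x0 + s • e) ≤ l * (0 - s) at this
      nlinarith
    · subst h; simp
    · have := hcv.rightDeriv_le_slope_of_mem_interior h0i hs h
      rw [slope_def_field, le_div_iff₀ (by linarith), hφ0] at this
      change rr * (s - 0) ≤ v (x0 + s • e) - v x0 at this
      nlinarith
  obtain ⟨p, hp, hpe⟩ := aux_exists_subgrad hΩo hv hvc hx0 e l (hsl l le_rfl hLR)
  obtain ⟨p', hp', hpe'⟩ := aux_exists_subgrad hΩo hv hvc hx0 e rr (hsl rr hLR le_rfl)
  have hpos : 0 < rr - l := by linarith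
  refine ⟨p, hp, p', hp', (1 / (rr - l)) • e, ?_, ?_⟩
  · rw [inner_smul_right, inner_sub_left, hpe, hpe']
    field_simp
  · rw [inner_smul_right, hpe]
    have h1 : HasDerivWithinAt (fun s : ℝ => s * (1 / (rr - l))) (1 / (rr - l)) (Iio 0) 0 := by
      simpa using ((hasDerivAt_id (0:ℝ)).mul_const (1 / (rr - l))).hasDerivWithinAt
    have hL' : HasDerivWithinAt φ l (Iio 0) ((0:ℝ) * (1 / (rr - l))) := by simpa using hL
    have h2 := hL'.comp (0:ℝ) h1 (fun s hs => by
      have hs' : s < 0 := hs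
      exact mul_neg_of_neg_of_pos hs' (by positivity))
    have e3 : (fun s : ℝ => v (x0 + s • (1 / (rr - l)) • e)) = φ ∘ fun s => s * (1 / (rr - l)) := by
      ext s
      simp [hφ, smul_smul]
    rw [mul_comm, e3]
    exact h2

open scoped Pointwise

abbrev auxB (n : ℕ) : Module.Basis (Fin n) ℝ (EuclideanSpace ℝ (Fin n)) :=
  (EuclideanSpace.basisFun (Fin n) ℝ).toBasis

lemma aux_basis {n : ℕ} {K : Set (EuclideanSpace ℝ (Fin n))} (hK : IsCompact K)
    (h0 : K ∈ nhds (0 : EuclideanSpace ℝ (Fin n))) :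
    ∃ b : Module.Basis (Fin n) ℝ (EuclideanSpace ℝ (Fin n)),
      (∀ i, b i ∈ K) ∧ ∀ x ∈ K, ∀ i, |b.repr x i| ≤ 1 := by
  obtain ⟨ρ, hρ, hball⟩ := Metric.nhds_basis_closedBall.mem_iff.1 h0
  have hcomp : IsCompact (Set.pi univ (fun _ : Fin n => K)) := isCompact_univ_pi (fun _ => hK)
  have hcont : Continuous (fun u : Fin n → EuclideanSpace ℝ (Fin n) => |(auxB n).det u|) := by
    apply Continuous.abs
    have he : (fun u : Fin n → EuclideanSpace ℝ (Fin n) => (auxB n).det u) =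
        fun u => (Matrix.of fun i j => u j i).det := by
      ext u
      rw [Module.Basis.det_apply]
      congr 1
    change Continuous (fun u : Fin n → EuclideanSpace ℝ (Fin n) => (auxB n).det u)
    rw [he]
    apply Continuous.matrix_det
    apply continuous_matrix
    intro i j
    simp only [Matrix.of_apply]
    fun_prop
  have hmem : (fun i => ρ • (auxB n) i) ∈ Set.pi univ (fun _ : Fin n => K) := by
    intro i _
    apply hball
    simp [auxB, norm_smul, abs_of_pos hρ]
  obtain ⟨u, huK, hmax⟩ := hcomp.exists_isMaxOn ⟨_, hmem⟩ hcont.continuousOn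
  have hpos : 0 < |(auxB n).det u| := by
    refine lt_of_lt_of_le ?_ (hmax hmem)
    have : (auxB n).det (fun i => ρ • (auxB n) i) = ρ ^ n := by
      rw [show (fun i => ρ • (auxB n) i) = fun i => (fun _ : Fin n => ρ) i • (auxB n) i from rfl,
        AlternatingMap.map_smul_univ, Module.Basis.det_self]
      simp
    show 0 < |(auxB n).det (fun i => ρ • (auxB n) i)|
    rw [this]
    positivity
  have hne : (auxB n).det u ≠ 0 := abs_pos.1 hpos
  obtain ⟨hli, hsp⟩ := ((auxB n).is_basis_iff_det).2 (isUnit_iff_ne_zero.2 hne)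
  refine ⟨Module.Basis.mk hli hsp.ge, ?_, ?_⟩
  · intro i
    rw [Module.Basis.mk_apply]
    exact huK i (mem_univ _)
  · intro x hx i
    have h1 := (auxB n).det_smul_mk_coord_eq_det_update hli hsp.ge i
    have h2 := congrArg (fun f => f x) h1
    simp at h2
    have h3 : |(auxB n).det (Function.update u i x)| ≤ |(auxB n).det u| := by
      apply hmax
      intro j _
      by_cases hj : j = i
      · subst hj; simpa using hx
      · simpa [hj] using huK j (mem_univ _)
    rw [← h2, abs_mul] at h3
    have h4 := le_of_mul_le_mul_left (h3.trans_eq (mul_one _).symm) hpos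
    simpa using h4

def auxQ (n : ℕ) : Set (EuclideanSpace ℝ (Fin n)) := {y | ∀ i, 0 ≤ y i ∧ y i ≤ 1}

lemma auxQ_compact (n : ℕ) : IsCompact (auxQ n) := by
  have h : IsCompact (Set.pi univ fun _ : Fin n => Icc (0:ℝ) 1) :=
    isCompact_univ_pi fun _ => isCompact_Icc
  have h2 := (EuclideanSpace.equiv (Fin n) ℝ).toHomeomorph.isCompact_preimage.2 h
  convert h2 using 1
  ext y
  simp [auxQ, Pi.le_def, forall_and]

lemma auxQ_pos (n : ℕ) (μ : Measure (EuclideanSpace ℝ (Fin n))) [μ.IsAddHaarMeasure] :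
    μ (auxQ n) ≠ 0 := by
  have ho : IsOpen {y : EuclideanSpace ℝ (Fin n) | ∀ i, 0 < y i ∧ y i < 1} := by
    have he : {y : EuclideanSpace ℝ (Fin n) | ∀ i, 0 < y i ∧ y i < 1} =
        ⋂ i, (fun y : EuclideanSpace ℝ (Fin n) => y i) ⁻¹' (Ioo 0 1) := by
      ext y; simp
    rw [he]
    apply isOpen_iInter_of_finite
    intro i
    exact isOpen_Ioo.preimage (by fun_prop)
  have hne : {y : EuclideanSpace ℝ (Fin n) | ∀ i, 0 < y i ∧ y i < 1}.Nonempty :=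
    ⟨WithLp.toLp 2 (fun _ => 1/2), fun i => by norm_num⟩
  have h1 := ho.measure_pos μ hne
  have h2 : {y : EuclideanSpace ℝ (Fin n) | ∀ i, 0 < y i ∧ y i < 1} ⊆ auxQ n := by
    intro y hy i
    exact ⟨(hy i).1.le, (hy i).2.le⟩
  exact (h1.trans_le (measure_mono h2)).ne'

def auxL {n : ℕ} (b : Module.Basis (Fin n) ℝ (EuclideanSpace ℝ (Fin n))) :
    EuclideanSpace ℝ (Fin n) →ₗ[ℝ] EuclideanSpace ℝ (Fin n) :=
  ((auxB n).equiv b (Equiv.refl _)).toLinearMap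

lemma auxL_det {n : ℕ} (b : Module.Basis (Fin n) ℝ (EuclideanSpace ℝ (Fin n))) :
    LinearMap.det (auxL b) ≠ 0 :=
  (LinearEquiv.isUnit_det' _).ne_zero

lemma auxL_repr {n : ℕ} (b : Module.Basis (Fin n) ℝ (EuclideanSpace ℝ (Fin n)))
    (y : EuclideanSpace ℝ (Fin n)) (i : Fin n) : b.repr (auxL b y) i = y i := by
  simp [auxL, Module.Basis.equiv, auxB]

lemma auxL_basis {n : ℕ} (b : Module.Basis (Fin n) ℝ (EuclideanSpace ℝ (Fin n)))
    (i : Fin n) : auxL b (EuclideanSpace.single i 1) = b i := by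
  apply b.repr.injective
  ext j
  rw [auxL_repr]
  simp [Finsupp.single_apply, eq_comm]

lemma auxT_apply {n : ℕ} (b : Module.Basis (Fin n) ℝ (EuclideanSpace ℝ (Fin n)))
    (p : EuclideanSpace ℝ (Fin n)) (i : Fin n) :
    (LinearMap.adjoint (auxL b) p) i = ⟪p, b i⟫ := by
  rw [← auxL_basis, ← LinearMap.adjoint_inner_left]
  simp [EuclideanSpace.inner_single_right]

lemma auxT_det {n : ℕ} (b : Module.Basis (Fin n) ℝ (EuclideanSpace ℝ (Fin n))) :
    LinearMap.det (LinearMap.adjoint (auxL b)) = LinearMap.det (auxL b) := by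
  rw [← LinearMap.det_toMatrix (auxB n), ← LinearMap.det_toMatrix (auxB n),
    LinearMap.toMatrix_adjoint]
  simp

lemma aux_meas_up {n : ℕ} (μ : Measure (EuclideanSpace ℝ (Fin n))) [μ.IsAddHaarMeasure]
    (b : Module.Basis (Fin n) ℝ (EuclideanSpace ℝ (Fin n))) {M : ℝ} (hM : 0 < M) :
    μ {p | ∀ i, |⟪p, b i⟫| ≤ M} ≤
      ENNReal.ofReal (|LinearMap.det (auxL b)|⁻¹ * (2 * M) ^ n) * μ (auxQ n) := by
  have h1 : {p | ∀ i, |⟪p, b i⟫| ≤ M} ⊆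
      (LinearMap.adjoint (auxL b)) ⁻¹'
        ((fun x => WithLp.toLp 2 (fun _ => -M) + x) '' ((2 * M) • auxQ n)) := by
    intro p hp
    refine ⟨LinearMap.adjoint (auxL b) p - WithLp.toLp 2 (fun _ => -M), ?_, add_sub_cancel _ _⟩
    rw [Set.mem_smul_set_iff_inv_smul_mem₀ (by positivity)]
    intro i
    have := abs_le.1 (hp i)
    simp only [PiLp.smul_apply, PiLp.sub_apply, auxT_apply, smul_eq_mul]
    rw [← div_eq_inv_mul]
    constructor
    · apply div_nonneg <;> linarith
    · rw [div_le_one (by linarith)]; linarith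
  refine (measure_mono h1).trans ?_
  rw [Measure.addHaar_preimage_linearMap _ (by rw [auxT_det]; exact auxL_det b), auxT_det,
    Set.image_add_left, measure_preimage_add, Measure.addHaar_smul, ← mul_assoc,
    ← ENNReal.ofReal_mul (by positivity), abs_inv]
  simp [abs_of_pos hM]

lemma aux_meas_K {n : ℕ} (μ : Measure (EuclideanSpace ℝ (Fin n))) [μ.IsAddHaarMeasure]
    (b : Module.Basis (Fin n) ℝ (EuclideanSpace ℝ (Fin n))) :
    μ {x | ∀ i, |b.repr x i| ≤ 1} ≤
      ENNReal.ofReal (2 ^ n * |LinearMap.det (auxL b)|) * μ (auxQ n) := by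
  have h1 : {x | ∀ i, |b.repr x i| ≤ 1} ⊆
      ((fun x => auxL b (WithLp.toLp 2 (fun _ => -1)) + x) '' (((2:ℝ) • auxL b) '' auxQ n)) := by
    intro x hx
    refine ⟨x - auxL b (WithLp.toLp 2 (fun _ => -1)), ?_, add_sub_cancel _ _⟩
    refine ⟨WithLp.toLp 2 (fun i => (b.repr x i + 1) / 2), ?_, ?_⟩
    · intro i
      have := abs_le.1 (hx i)
      constructor <;> simp <;> linarith
    · apply b.repr.injective
      ext i
      simp [auxL_repr]
      ring
  refine (measure_mono h1).trans ?_
  rw [Set.image_add_left, measure_preimage_add, Measure.addHaar_image_linearMap,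
    LinearMap.det_smul]
  simp [abs_mul]

lemma aux_meas_cube {n : ℕ} (μ : Measure (EuclideanSpace ℝ (Fin n))) [μ.IsAddHaarMeasure]
    (b : Module.Basis (Fin n) ℝ (EuclideanSpace ℝ (Fin n))) (c : EuclideanSpace ℝ (Fin n))
    {r : ℝ} (hr : 0 < r) :
    μ ((fun x => c + x) '' ((r • auxL b) '' auxQ n)) =
      ENNReal.ofReal (r ^ n * |LinearMap.det (auxL b)|) * μ (auxQ n) := by
  rw [Set.image_add_left, measure_preimage_add, Measure.addHaar_image_linearMap,
    LinearMap.det_smul]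
  simp [abs_mul, abs_of_pos hr]

def auxM {n : ℕ} (i : Fin n) (c : Fin n → ℝ) : Matrix (Fin n) (Fin n) ℝ :=
  Matrix.updateCol ((1 / (n:ℝ)) • 1) i c

lemma auxM_det {n : ℕ} (i : Fin n) (c : Fin n → ℝ) :
    (auxM i c).det = (1 / (n:ℝ)) ^ (n - 1) * c i := by
  rw [auxM, ← Matrix.cramer_apply, Matrix.cramer_smul]
  simp

lemma auxM_mulVec {n : ℕ} (i : Fin n) (c : Fin n → ℝ) (y : Fin n → ℝ) (j : Fin n) :
    (auxM i c).mulVec y j = (if j = i then 0 else y j / n) + y i * c j := by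
  have : ∀ k, auxM i c j k * y k = (if k = i then y i * c j else 0) +
      (if k = j then (if j = i then 0 else y j / n) else 0) := by
    intro k
    rw [auxM, Matrix.updateCol_apply]
    by_cases h1 : k = i
    · subst h1
      by_cases h2 : k = j
      · subst h2; simp; ring
      · simp [h2]; ring
    · by_cases h2 : k = j
      · subst h2; simp [h1]; ring
      · simp [h1, h2, Ne.symm h2]
  rw [Matrix.mulVec, dotProduct]
  simp only [this, Finset.sum_add_distrib]
  simp [add_comm]

lemma aux_meas_low {n : ℕ} (μ : Measure (EuclideanSpace ℝ (Fin n))) [μ.IsAddHaarMeasure]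
    (b : Module.Basis (Fin n) ℝ (EuclideanSpace ℝ (Fin n))) {h : ℝ} (hh : 0 < h)
    (i : Fin n) (c : Fin n → ℝ) :
    ENNReal.ofReal (|LinearMap.det (auxL b)|⁻¹ *
        ((h / 2) ^ n * ((1 / (n:ℝ)) ^ (n - 1) * |c i|))) * μ (auxQ n) ≤
      μ {p | ∃ y ∈ auxQ n, ∀ j, ⟪p, b j⟫ =
        (h / 2) * ((if j = i then 0 else y j / n) + y i * c j)} := by
  have h1 : (LinearMap.adjoint (auxL b)) ⁻¹'
      ((((h / 2) • Matrix.toEuclideanLin (auxM i c)) '' auxQ n)) ⊆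
      {p | ∃ y ∈ auxQ n, ∀ j, ⟪p, b j⟫ =
        (h / 2) * ((if j = i then 0 else y j / n) + y i * c j)} := by
    rintro p ⟨y, hy, hyp⟩
    refine ⟨y, hy, fun j => ?_⟩
    rw [← auxT_apply, ← hyp, ← auxM_mulVec]
    simp [Matrix.toLpLin_apply]
  refine le_trans (le_of_eq ?_) (measure_mono h1)
  rw [Measure.addHaar_preimage_linearMap _ (by rw [auxT_det]; exact auxL_det b), auxT_det,
    Measure.addHaar_image_linearMap, LinearMap.det_smul,
    Matrix.toEuclideanLin_eq_toLin_orthonormal, LinearMap.det_toLin, auxM_det,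
    ← mul_assoc (ENNReal.ofReal _), ← ENNReal.ofReal_mul (by positivity)]
  simp only [abs_mul, abs_inv, abs_pow, finrank_euclideanSpace, Fintype.card_fin]
  rw [abs_of_pos (by positivity : (0:ℝ) < h / 2), abs_of_nonneg (by positivity : (0:ℝ) ≤ 1 / n)]

lemma aux_expand {n : ℕ} (b : Module.Basis (Fin n) ℝ (EuclideanSpace ℝ (Fin n)))
    (p x : EuclideanSpace ℝ (Fin n)) : ⟪p, x⟫ = ∑ j, b.repr x j * ⟪p, b j⟫ := by
  conv_lhs => rw [← b.sum_repr x]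
  rw [inner_sum]
  simp [inner_smul_right]

/-- points below the cone are subgradients somewhere in `K`. -/
lemma aux_cone {n : ℕ} {Ω K : Set (EuclideanSpace ℝ (Fin n))}
    {w : EuclideanSpace ℝ (Fin n) → ℝ} (hw : ConvexOn ℝ Ω w)
    (hwc : ContinuousOn w Ω) (h0 : (0 : EuclideanSpace ℝ (Fin n)) ∈ Ω)
    (hKdef : K = {x ∈ Ω | w x ≤ 0}) (hK : IsCompact K) {h : ℝ} (hh : 0 < h) (hw0 : w 0 = -h)
    {p : EuclideanSpace ℝ (Fin n)} (hp : ∀ x ∈ K, ⟪p, x⟫ ≤ h) :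
    p ∈ ⋃ x ∈ K, subgrad Ω w x := by
  have hKΩ : K ⊆ Ω := by rw [hKdef]; exact fun x hx => hx.1
  have h0K : (0 : EuclideanSpace ℝ (Fin n)) ∈ K := by
    rw [hKdef]; exact ⟨h0, by rw [hw0]; linarith⟩
  obtain ⟨x, hxK, hx⟩ := hK.exists_isMinOn ⟨0, h0K⟩
    (f := fun y => w y - ⟪p, y⟫) ((hwc.mono hKΩ).sub (by fun_prop))
  simp only [mem_iUnion]
  refine ⟨x, hxK, fun y hy => ?_⟩
  have hmin : ∀ z ∈ K, w x - ⟪p, x⟫ ≤ w z - ⟪p, z⟫ := fun z hz => hx hz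
  suffices w x - ⟪p, x⟫ ≤ w y - ⟪p, y⟫ by
    rw [inner_sub_right]; linarith
  by_cases hyK : y ∈ K
  · exact hmin y hyK
  have hwy : 0 < w y := by
    by_contra hcon
    exact hyK (by rw [hKdef]; exact ⟨hy, not_lt.1 hcon⟩)
  have hm0 := hmin 0 h0K
  simp only [inner_zero_right, hw0] at hm0
  have hseg : ∀ s ∈ Icc (0:ℝ) 1, s • y ∈ Ω := by
    intro s hs
    have := hw.1 h0 hy (by linarith [hs.2] : 0 ≤ 1 - s) hs.1 (by ring)
    simpa using this
  have hcs : ContinuousOn (fun s : ℝ => w (s • y)) (Icc 0 1) :=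
    hwc.comp (by fun_prop) hseg
  have hivt := intermediate_value_Icc (zero_le_one' ℝ) hcs
  obtain ⟨s, hs, hsw⟩ := hivt (show (0:ℝ) ∈ Icc (w ((0:ℝ) • y)) (w ((1:ℝ) • y)) by
    simp only [zero_smul, one_smul, hw0]
    exact ⟨by linarith, hwy.le⟩)
  simp only at hsw
  have hsK : s • y ∈ K := by rw [hKdef]; exact ⟨hseg s hs, hsw.le⟩
  have hps := hp _ hsK
  rw [inner_smul_right] at hps
  have hcv := hw.2 h0 hy (by linarith [hs.2] : 0 ≤ 1 - s) hs.1 (by ring)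
  simp only [smul_zero, zero_add, hsw, hw0, smul_eq_mul] at hcv
  have hs0 : 0 < s := by
    rcases hs.1.lt_or_eq with h' | h'
    · exact h'
    · exfalso
      rw [← h', zero_smul, hw0] at hsw
      linarith
  have : 0 ≤ s * (w y - ⟪p, y⟫ + h) := by nlinarith
  have := nonneg_of_mul_nonneg_right this hs0
  linarith

lemma aux_core_s19 {n : ℕ} (hn : 1 ≤ n) (μ : Measure (EuclideanSpace ℝ (Fin n))) [μ.IsAddHaarMeasure]
    {Ω K : Set (EuclideanSpace ℝ (Fin n))} (hΩo : IsOpen Ω)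
    {w : EuclideanSpace ℝ (Fin n) → ℝ} (hw : ConvexOn ℝ Ω w)
    (hwc : ContinuousOn w Ω) (h0 : (0 : EuclideanSpace ℝ (Fin n)) ∈ Ω)
    (hKdef : K = {x ∈ Ω | w x ≤ 0}) (hK : IsCompact K) {h : ℝ} (hh : 0 < h) (hw0 : w 0 = -h)
    (hlow : ∀ x ∈ K, -(2 * h) ≤ w x) (q : EuclideanSpace ℝ (Fin n)) {β t : ℝ} (hβ : 0 < β)
    (hqβ : ∀ x ∈ K, ⟪q, x⟫ ≤ β) (hqt : ∃ x ∈ K, t / 2 ≤ |⟪q, x⟫|)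
    {lam1 lam2 : ℝ} (hlam1 : 0 < lam1) (hlam2 : 0 < lam2)
    (hma : ∀ ω : Set (EuclideanSpace ℝ (Fin n)), MeasurableSet ω → ω ⊆ Ω →
      ENNReal.ofReal lam1 * μ ω ≤ μ (⋃ x ∈ ω, subgrad Ω w x) ∧
        μ (⋃ x ∈ ω, subgrad Ω w x) ≤ ENNReal.ofReal lam2 * μ ω) :
    t / β ≤ 2 * (lam2 / lam1) * (128 * (n:ℝ) ^ 3) ^ n := by
  have hnpos : (0:ℝ) < n := by exact_mod_cast hn
  have hKΩ : K ⊆ Ω := by rw [hKdef]; exact fun x hx => hx.1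
  have hK0 : K ∈ nhds (0 : EuclideanSpace ℝ (Fin n)) := by
    have h1 : ContinuousAt w 0 := hwc.continuousAt (hΩo.mem_nhds h0)
    have h2 : ∀ᶠ x in nhds 0, w x < 0 := h1.eventually_lt_const (by rw [hw0]; linarith)
    filter_upwards [h2, hΩo.mem_nhds h0] with x hx hx'
    rw [hKdef]; exact ⟨hx', hx.le⟩
  have h0K := mem_of_mem_nhds hK0
  have hKc : Convex ℝ K := by rw [hKdef]; exact hw.convex_le 0
  obtain ⟨b, hbK, hb⟩ := aux_basis hK hK0
  set D := |LinearMap.det (auxL b)| with hD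
  have hDpos : 0 < D := abs_pos.2 (auxL_det b)
  have hκ0 := auxQ_pos n μ
  have hκt : μ (auxQ n) ≠ ⊤ := (auxQ_compact n).measure_lt_top.ne
  -- points with nonnegative coordinates of sum at most one lie in K
  have hsimp : ∀ x, (∀ i, 0 ≤ b.repr x i) → ∑ i, b.repr x i ≤ 1 → x ∈ K := by
    intro x hx1 hx2
    have h1 := hKc.sum_mem (t := (Finset.univ : Finset (Option (Fin n))))
      (w := fun o => o.elim (1 - ∑ i, b.repr x i) (fun i => b.repr x i))
      (z := fun o => o.elim 0 (fun i => b i))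
      (by rintro (_ | i) _ <;> simp [hx1, hx2])
      (by rw [Fintype.sum_option]; simp) (by rintro (_ | i) _ <;> simp [h0K, hbK])
    rw [Fintype.sum_option] at h1
    simp only [Option.elim, smul_zero, zero_add] at h1
    rwa [b.sum_repr] at h1
  -- lower bound
  have hI : lam1 * ((1 / (2 * (n:ℝ))) ^ n * D) ≤ D⁻¹ * (2 * (8 * n * h)) ^ n := by
    set c := auxL b (WithLp.toLp 2 (fun _ => 1 / (4 * (n:ℝ)))) with hc
    set ω := ((fun x => c + x) '' (((1 / (2 * (n:ℝ))) • auxL b) '' auxQ n)) with hω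
    have hωm : MeasurableSet ω := by
      apply IsCompact.measurableSet
      apply IsCompact.image _ (by fun_prop)
      exact (auxQ_compact n).image (LinearMap.continuous_of_finiteDimensional _)
    have hrep : ∀ x ∈ ω, ∀ i, 1 / (4 * (n:ℝ)) ≤ b.repr x i ∧ b.repr x i ≤ 3 / (4 * (n:ℝ)) := by
      rintro _ ⟨_, ⟨y, hy, rfl⟩, rfl⟩ i
      have e : b.repr (c + ((1 / (2 * (n:ℝ))) • auxL b) y) i =
          1 / (4 * (n:ℝ)) + (1 / (2 * (n:ℝ))) * y i := by
        simp [hc, auxL_repr]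
      simp only [e]
      have h1 := hy i
      have h2 : 0 < 1 / (2 * (n:ℝ)) := by positivity
      have h3 : 3 / (4 * (n:ℝ)) = 1 / (4 * (n:ℝ)) + (1 / (2 * (n:ℝ))) * 1 := by
        field_simp; norm_num
      rw [h3]
      constructor
      · nlinarith [mul_nonneg h2.le h1.1]
      · have := mul_le_mul_of_nonneg_left h1.2 h2.le
        linarith
    have hnb : ∀ x ∈ ω, ∀ i, ∀ s : ℝ, |s| ≤ 1 / (4 * (n:ℝ)) → x + s • b i ∈ K := by
      intro x hx i s hs
      have hs' := abs_le.1 hs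
      have e : ∀ j, b.repr (x + s • b i) j = b.repr x j + (if j = i then s else 0) := by
        intro j
        simp [Finsupp.single_apply, eq_comm]
      have h4 : 0 < 1 / (4 * (n:ℝ)) := by positivity
      apply hsimp
      · intro j
        rw [e]
        have := (hrep x hx j).1
        split_ifs <;> linarith
      · simp only [e, Finset.sum_add_distrib]
        have h1 : ∑ j, b.repr x j ≤ ∑ j : Fin n, 3 / (4 * (n:ℝ)) :=
          Finset.sum_le_sum fun j _ => (hrep x hx j).2
        have h2 : ∑ j : Fin n, 3 / (4 * (n:ℝ)) = 3 / 4 := by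
          simp; field_simp
        have h3 : 1 / (4 * (n:ℝ)) ≤ 1 / 4 := by
          apply one_div_le_one_div_of_le (by norm_num)
          have : (1:ℝ) ≤ n := by exact_mod_cast hn
          linarith
        simp only [Finset.sum_ite_eq', Finset.mem_univ, if_true]
        linarith
    have hωK : ω ⊆ K := by
      intro x hx
      have := hnb x hx ⟨0, hn⟩ 0 (by simp)
      simpa using this
    have hsub : (⋃ x ∈ ω, subgrad Ω w x) ⊆ {p | ∀ i, |⟪p, b i⟫| ≤ 8 * n * h} := by
      intro p hp i
      simp only [mem_iUnion] at hp
      obtain ⟨x, hx, hp⟩ := hp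
      have hbd : ∀ s : ℝ, |s| ≤ 1 / (4 * (n:ℝ)) → s * ⟪p, b i⟫ ≤ 2 * h := by
        intro s hs
        have hm := hnb x hx i s hs
        have h1 := hp _ (hKΩ hm)
        have h2 := hlow x (hωK hx)
        have h3 : w (x + s • b i) ≤ 0 := by
          rw [hKdef] at hm; exact hm.2
        simp only [add_sub_cancel_left, inner_smul_right] at h1
        linarith
      have h4 : 0 < 1 / (4 * (n:ℝ)) := by positivity
      have h5 := hbd (1 / (4 * (n:ℝ))) (abs_of_pos h4).le
      have h6 := hbd (-(1 / (4 * (n:ℝ)))) (by rw [abs_neg]; exact (abs_of_pos h4).le)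
      have e1 : 8 * n * h = (2 * h) * (4 * n) := by ring
      rw [e1, abs_le]
      have h7 : ∀ a : ℝ, 1 / (4 * (n:ℝ)) * a ≤ 2 * h → a ≤ (2 * h) * (4 * n) := by
        intro a ha
        rwa [one_div, ← div_eq_inv_mul, div_le_iff₀ (by positivity)] at ha
      have h8 := h7 _ h5
      have h9 := h7 (-⟪p, b i⟫) (by linarith)
      exact ⟨by linarith, h8⟩
    have h1 := (hma ω hωm (hωK.trans hKΩ)).1
    have h2 := (h1.trans (measure_mono hsub)).trans (aux_meas_up μ b (by positivity))
    rw [hω, aux_meas_cube μ b c (by positivity), ← mul_assoc,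
      ← ENNReal.ofReal_mul hlam1.le, ENNReal.mul_le_mul_iff_left hκ0 hκt,
      ENNReal.ofReal_le_ofReal_iff (by positivity)] at h2
    exact h2
  -- upper bound
  obtain ⟨i, hi⟩ : ∃ i, t / (2 * n) ≤ |⟪q, b i⟫| := by
    obtain ⟨x, hxK, hx⟩ := hqt
    by_contra! hcon
    have h1 : |⟪q, x⟫| ≤ ∑ j, |⟪q, b j⟫| := by
      rw [aux_expand b q x]
      refine (Finset.abs_sum_le_sum_abs _ _).trans (Finset.sum_le_sum fun j _ => ?_)
      rw [abs_mul]
      have := mul_le_mul_of_nonneg_right (hb x hxK j) (abs_nonneg ⟪q, b j⟫)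
      linarith
    have h2 : ∑ j, |⟪q, b j⟫| < ∑ j : Fin n, t / (2 * n) := by
      apply Finset.sum_lt_sum_of_nonempty ⟨⟨0, hn⟩, Finset.mem_univ _⟩
      intro j _
      exact hcon j
    have h3 : ∑ j : Fin n, t / (2 * (n:ℝ)) = t / 2 := by
      simp; field_simp
    linarith
  have hII : D⁻¹ * ((h / 2) ^ n * ((1 / (n:ℝ)) ^ (n - 1) * |⟪q, b i⟫ / β|)) ≤
      lam2 * (2 ^ n * D) := by
    have hsub : {p | ∃ y ∈ auxQ n, ∀ j, ⟪p, b j⟫ =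
        (h / 2) * ((if j = i then 0 else y j / n) + y i * (⟪q, b j⟫ / β))} ⊆
        ⋃ x ∈ K, subgrad Ω w x := by
      rintro p ⟨y, hy, hp⟩
      apply aux_cone hw hwc h0 hKdef hK hh hw0
      intro x hx
      have e1 : ⟪p, x⟫ = (h / 2) * (∑ j, b.repr x j * (if j = i then 0 else y j / n)
          + y i / β * ⟪q, x⟫) := by
        rw [aux_expand b p x, aux_expand b q x, Finset.mul_sum, ← Finset.sum_add_distrib,
          Finset.mul_sum]
        apply Finset.sum_congr rfl
        intro j _
        rw [hp j]
        ring
      have h1 : ∑ j, b.repr x j * (if j = i then 0 else y j / n) ≤ ∑ j : Fin n, 1 / (n:ℝ) := by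
        apply Finset.sum_le_sum
        intro j _
        split_ifs
        · simp
        · have h2 := (abs_le.1 (hb x hx j)).2
          have h3 := hy j
          rw [← mul_div_assoc]
          apply div_le_div_of_nonneg_right _ hnpos.le
          nlinarith
      have h2 : ∑ j : Fin n, 1 / (n:ℝ) = 1 := by simp [hnpos.ne']
      have h3 : y i / β * ⟪q, x⟫ ≤ 1 := by
        have h4 := mul_le_mul_of_nonneg_left (hqβ x hx) (div_nonneg (hy i).1 hβ.le)
        rw [div_mul_cancel₀ _ hβ.ne'] at h4
        exact h4.trans (hy i).2
      rw [e1]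
      nlinarith
    have h1 := (hma K hK.measurableSet hKΩ).2
    have h2 := ((aux_meas_low μ b hh i (fun j => ⟪q, b j⟫ / β)).trans (measure_mono hsub)).trans h1
    have h3 : μ K ≤ μ {x | ∀ i, |b.repr x i| ≤ 1} := measure_mono fun x hx => hb x hx
    have h4 := h2.trans (mul_le_mul_right (h3.trans (aux_meas_K μ b)) _)
    rw [← mul_assoc (ENNReal.ofReal lam2), ← ENNReal.ofReal_mul hlam2.le, ENNReal.mul_le_mul_iff_left hκ0 hκt,
      ENNReal.ofReal_le_ofReal_iff (by positivity)] at h4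
    exact h4
  -- algebra
  have hXpos : 0 < h ^ n := by positivity
  have hA : lam1 * D ^ 2 ≤ (32 * (n:ℝ) ^ 2) ^ n * h ^ n := by
    have h1 := mul_le_mul_of_nonneg_left hI (by positivity : 0 ≤ D * (2 * (n:ℝ)) ^ n)
    have e1 : D * (2 * (n:ℝ)) ^ n * (lam1 * ((1 / (2 * (n:ℝ))) ^ n * D)) = lam1 * D ^ 2 := by
      rw [one_div, inv_pow]; field_simp
    have e2 : D * (2 * (n:ℝ)) ^ n * (D⁻¹ * (2 * (8 * n * h)) ^ n) =
        (32 * (n:ℝ) ^ 2) ^ n * h ^ n := by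
      rw [show D * (2 * (n:ℝ)) ^ n * (D⁻¹ * (2 * (8 * n * h)) ^ n) =
        (D * D⁻¹) * ((2 * (n:ℝ)) ^ n * (2 * (8 * n * h)) ^ n) by ring,
        mul_inv_cancel₀ hDpos.ne', one_mul, ← mul_pow, ← mul_pow]
      congr 1
      ring
    rwa [e1, e2] at h1
  have hB : h ^ n * (t / β) ≤ 2 * lam2 * (4 * (n:ℝ)) ^ n * D ^ 2 := by
    have h1 := mul_le_mul_of_nonneg_left hII (by positivity : 0 ≤ 2 * D * (2 * (n:ℝ)) ^ n)
    have e1 : (n:ℝ) ^ n * (1 / (n:ℝ)) ^ (n - 1) = n := by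
      obtain ⟨m, rfl⟩ : ∃ m, n = m + 1 := ⟨n - 1, by omega⟩
      rw [Nat.add_sub_cancel, pow_succ, one_div, inv_pow]
      field_simp
    have e2 : 2 * D * (2 * (n:ℝ)) ^ n * (D⁻¹ * ((h / 2) ^ n * ((1 / (n:ℝ)) ^ (n - 1) * |⟪q, b i⟫ / β|)))
        = h ^ n * (2 * n * |⟪q, b i⟫| / β) := by
      rw [abs_div, abs_of_pos hβ, div_pow, mul_pow]
      calc _ = (D * D⁻¹) * (2 ^ n * (1 / 2 ^ n)) * h ^ n *
            (2 * ((n:ℝ) ^ n * (1 / (n:ℝ)) ^ (n - 1)) * |⟪q, b i⟫| / β) := by ring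
        _ = _ := by
          rw [e1, mul_inv_cancel₀ hDpos.ne', mul_one_div_cancel (by positivity)]
          ring
    have e3 : 2 * D * (2 * (n:ℝ)) ^ n * (lam2 * (2 ^ n * D)) = 2 * lam2 * (4 * (n:ℝ)) ^ n * D ^ 2 := by
      rw [show (4 * (n:ℝ)) = (2 * n) * 2 by ring, mul_pow (2 * (n:ℝ))]
      ring
    rw [e2, e3] at h1
    refine le_trans ?_ h1
    apply mul_le_mul_of_nonneg_left _ hXpos.le
    apply div_le_div_of_nonneg_right _ hβ.le
    rw [div_le_iff₀ (by positivity)] at hi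
    linarith
  have hC : lam1 * (h ^ n * (t / β)) ≤ 2 * lam2 * (128 * (n:ℝ) ^ 3) ^ n * h ^ n := by
    calc lam1 * (h ^ n * (t / β)) ≤ lam1 * (2 * lam2 * (4 * (n:ℝ)) ^ n * D ^ 2) := by gcongr
      _ = 2 * lam2 * (4 * (n:ℝ)) ^ n * (lam1 * D ^ 2) := by ring
      _ ≤ 2 * lam2 * (4 * (n:ℝ)) ^ n * ((32 * (n:ℝ) ^ 2) ^ n * h ^ n) := by gcongr
      _ = 2 * lam2 * ((4 * (n:ℝ)) ^ n * (32 * (n:ℝ) ^ 2) ^ n) * h ^ n := by ring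
      _ = _ := by
        rw [← mul_pow]
        congr 3
        ring
  have hD' : h ^ n * (lam1 * (t / β)) ≤ h ^ n * (2 * lam2 * (128 * (n:ℝ) ^ 3) ^ n) := by linarith
  have hE := le_of_mul_le_mul_left hD' hXpos
  rw [show 2 * (lam2 / lam1) * (128 * (n:ℝ) ^ 3) ^ n =
    (2 * lam2 * (128 * (n:ℝ) ^ 3) ^ n) / lam1 by ring, le_div_iff₀ hlam1]
  linarith

lemma aux_translate {n : ℕ} (μ : Measure (EuclideanSpace ℝ (Fin n))) [μ.IsAddHaarMeasure]
    {Ω Ω' : Set (EuclideanSpace ℝ (Fin n))} (hΩm : MeasurableSet Ω)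
    {v v' : EuclideanSpace ℝ (Fin n) → ℝ} (x0 p : EuclideanSpace ℝ (Fin n)) (a : ℝ)
    (hΩ : ∀ y, y ∈ Ω' ↔ x0 + y ∈ Ω) (hv : ∀ y, v' y = v (x0 + y) - a - ⟪p, y⟫)
    {lam1 lam2 : ℝ}
    (hma : ∀ ω : Set (EuclideanSpace ℝ (Fin n)), MeasurableSet ω → ω ⊆ Ω →
      ENNReal.ofReal lam1 * μ ω ≤ μ (⋃ x ∈ ω, subgrad Ω v x) ∧
        μ (⋃ x ∈ ω, subgrad Ω v x) ≤ ENNReal.ofReal lam2 * μ ω) :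
    ∀ ω : Set (EuclideanSpace ℝ (Fin n)), MeasurableSet ω → ω ⊆ Ω' →
      ENNReal.ofReal lam1 * μ ω ≤ μ (⋃ x ∈ ω, subgrad Ω' v' x) ∧
        μ (⋃ x ∈ ω, subgrad Ω' v' x) ≤ ENNReal.ofReal lam2 * μ ω := by
  intro ω hω hsub
  have e1 : (⋃ x ∈ ω, subgrad Ω' v' x) =
      (fun z => z + p) ⁻¹' (⋃ x ∈ (fun y => -x0 + y) ⁻¹' ω, subgrad Ω v x) := by
    ext z
    simp only [mem_iUnion, mem_preimage, exists_prop]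
    constructor
    · rintro ⟨x, hx, hz⟩
      refine ⟨x0 + x, by simpa using hx, fun y hy => ?_⟩
      have := hz (-x0 + y) (by rw [hΩ]; simpa using hy)
      rw [hv, hv] at this
      simp only [add_neg_cancel_left, inner_sub_right, inner_add_left, inner_add_right,
        inner_neg_right] at this ⊢
      linarith
    · rintro ⟨x, hx, hz⟩
      refine ⟨-x0 + x, hx, fun y hy => ?_⟩
      have := hz (x0 + y) ((hΩ y).1 hy)
      rw [hv, hv]
      simp only [add_neg_cancel_left, inner_sub_right, inner_add_left, inner_add_right,
        inner_neg_right] at this ⊢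
      linarith
  have h := hma ((fun y => -x0 + y) ⁻¹' ω) (hω.preimage (by fun_prop)) (by
    intro y hy
    have := (hΩ _).1 (hsub hy)
    simpa using this)
  rw [measure_preimage_add] at h
  rw [e1, measure_preimage_add_right]
  exact h

lemma aux_final {n : ℕ} (hn : 1 ≤ n) (μ : Measure (EuclideanSpace ℝ (Fin n))) [μ.IsAddHaarMeasure]
    {Ω : Set (EuclideanSpace ℝ (Fin n))} (hΩo : IsOpen Ω)
    {u : EuclideanSpace ℝ (Fin n) → ℝ} (hu : ConvexOn ℝ Ω u)
    (huc : ContinuousOn u Ω) (h0 : (0 : EuclideanSpace ℝ (Fin n)) ∈ Ω) (hu0 : u 0 = 0)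
    (hupos : ∀ x ∈ Ω, x ≠ 0 → 0 < u x) (q e : EuclideanSpace ℝ (Fin n)) (hqe : ⟪q, e⟫ = 1)
    (huq : ∀ x ∈ Ω, ⟪q, x⟫ ≤ u x)
    (hder : HasDerivWithinAt (fun s : ℝ => u (s • e)) 0 (Iio 0) 0)
    {lam1 lam2 : ℝ} (hlam1 : 0 < lam1) (hlam2 : 0 < lam2)
    (hma : ∀ ω : Set (EuclideanSpace ℝ (Fin n)), MeasurableSet ω → ω ⊆ Ω →
      ENNReal.ofReal lam1 * μ ω ≤ μ (⋃ x ∈ ω, subgrad Ω u x) ∧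
        μ (⋃ x ∈ ω, subgrad Ω u x) ≤ ENNReal.ofReal lam2 * μ ω) : False := by
  have hunn : ∀ x ∈ Ω, 0 ≤ u x := by
    intro x hx
    by_cases h : x = 0
    · rw [h, hu0]
    · exact (hupos x hx h).le
  set C := 2 * (lam2 / lam1) * (128 * (n:ℝ) ^ 3) ^ n with hC
  have hC0 : 0 ≤ C := by positivity
  set δ := 1 / (C + 3) with hδ
  have hδ0 : 0 < δ := by positivity
  have hδ1 : δ * (C + 3) = 1 := by rw [hδ]; field_simp
  have hδ3 : δ ≤ 1 / 3 := by nlinarith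
  obtain ⟨ρ, hρ, hball⟩ := Metric.nhds_basis_closedBall.mem_iff.1 (hΩo.mem_nhds h0)
  have he0 : e ≠ 0 := by rintro rfl; simp at hqe
  have hsphΩ : Metric.sphere (0 : EuclideanSpace ℝ (Fin n)) ρ ⊆ Ω :=
    Metric.sphere_subset_closedBall.trans hball
  obtain ⟨z, hz, hzmin⟩ := (isCompact_sphere (0 : EuclideanSpace ℝ (Fin n)) ρ).exists_isMinOn
    ⟨(ρ / ‖e‖) • e, by
      have : ‖e‖ ≠ 0 := norm_ne_zero_iff.2 he0
      simp [norm_smul, abs_of_pos hρ, this]⟩ (huc.mono hsphΩ)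
  set m := u z with hm
  have hm0 : 0 < m := by
    apply hupos z (hsphΩ hz)
    rintro rfl
    simp at hz
    exact hρ.ne hz
  have hin : ∀ x ∈ Ω, u x < m → x ∈ Metric.closedBall (0 : EuclideanSpace ℝ (Fin n)) ρ := by
    intro x hx hxm
    by_contra hcon
    simp only [Metric.mem_closedBall, dist_zero_right, not_le] at hcon
    have hxn : 0 < ‖x‖ := hρ.trans hcon
    have hs1 : ρ / ‖x‖ ≤ 1 := by rw [div_le_one hxn]; exact hcon.le
    have hs0 : 0 ≤ ρ / ‖x‖ := by positivity
    have h1 := hu.2 h0 hx (by linarith : 0 ≤ 1 - ρ / ‖x‖) hs0 (by ring)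
    simp only [smul_zero, zero_add, hu0, smul_eq_mul] at h1
    have h2 : m ≤ u ((ρ / ‖x‖) • x) := by
      apply hzmin
      simp [norm_smul, abs_of_pos hρ, hxn.ne']
    have := hunn x hx
    nlinarith
  -- choose s
  obtain ⟨s, hs, hsΩ, hsu, hsm⟩ : ∃ s : ℝ, s < 0 ∧ s • e ∈ Ω ∧ u (s • e) ≤ δ * |s| ∧
      -(4 * δ * s) < m := by
    have a1 : ∀ᶠ s in nhdsWithin (0:ℝ) (Iio 0), s • e ∈ Ω := by
      apply mem_nhdsWithin_of_mem_nhds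
      have : Continuous (fun s : ℝ => s • e) := by fun_prop
      exact this.continuousAt.eventually_mem (by simpa using hΩo.mem_nhds h0)
    have a2 : ∀ᶠ s in nhdsWithin (0:ℝ) (Iio 0), -(4 * δ * s) < m := by
      apply mem_nhdsWithin_of_mem_nhds
      have : Continuous (fun s : ℝ => -(4 * δ * s)) := by fun_prop
      exact this.continuousAt.eventually_lt_const (by simpa using hm0)
    have a3 : ∀ᶠ s in nhdsWithin (0:ℝ) (Iio 0), u (s • e) ≤ δ * |s| := by
      rw [hasDerivWithinAt_iff_isLittleO, Asymptotics.isLittleO_iff] at hder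
      filter_upwards [hder hδ0] with s hs
      simp [hu0] at hs
      exact (le_abs_self _).trans hs
    have a4 : ∀ᶠ s in nhdsWithin (0:ℝ) (Iio 0), s < 0 := self_mem_nhdsWithin
    obtain ⟨s, h1, h2, h3, h4⟩ := (a4.and (a1.and (a3.and a2))).exists
    exact ⟨s, h1, h2, h3, h4⟩
  set t := -(2 * s) with ht
  have ht0 : 0 < t := by linarith
  set w : EuclideanSpace ℝ (Fin n) → ℝ := fun x => u x - δ * t - ⟪δ • q, x⟫ with hw
  have hwcv : ConvexOn ℝ Ω w := by
    have h1 : ConcaveOn ℝ Ω (fun x : EuclideanSpace ℝ (Fin n) => ⟪δ • q, x⟫) :=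
      (innerSL ℝ (δ • q)).toLinearMap.concaveOn hu.1
    have h2 := (hu.sub (concaveOn_const (δ * t) hu.1)).sub h1
    exact h2
  have hwc : ContinuousOn w Ω := (huc.sub continuousOn_const).sub (by fun_prop)
  have hwle : ∀ x ∈ Ω, w x ≤ 0 → u x ≤ δ * (⟪q, x⟫ + t) ∧ ⟪q, x⟫ ≤ δ * t / (1 - δ) := by
    intro x hx hwx
    simp only [hw, inner_smul_left, RCLike.conj_to_real] at hwx
    have h1 : u x ≤ δ * (⟪q, x⟫ + t) := by linarith
    refine ⟨h1, ?_⟩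
    rw [le_div_iff₀ (by linarith)]
    have := huq x hx
    linarith
  have hβt : δ * t / (1 - δ) ≤ t := by
    rw [div_le_iff₀ (by linarith)]
    nlinarith
  set K := {x ∈ Ω | w x ≤ 0} with hK
  have hKb : ∀ x ∈ K, x ∈ Metric.closedBall (0 : EuclideanSpace ℝ (Fin n)) ρ := by
    intro x hx
    obtain ⟨h1, h2⟩ := hwle x hx.1 hx.2
    apply hin x hx.1
    have : δ * (⟪q, x⟫ + t) ≤ δ * (2 * t) := by
      apply mul_le_mul_of_nonneg_left _ hδ0.le
      linarith
    have e3 : δ * (2 * t) = -(4 * δ * s) := by rw [ht]; ring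
    linarith
  have hKc : IsCompact K := by
    have e4 : K = Metric.closedBall (0 : EuclideanSpace ℝ (Fin n)) ρ ∩ w ⁻¹' (Iic 0) := by
      ext x
      exact ⟨fun hx => ⟨hKb x hx, hx.2⟩, fun hx => ⟨hball hx.1, hx.2⟩⟩
    rw [e4]
    apply (isCompact_closedBall (0 : EuclideanSpace ℝ (Fin n)) ρ).of_isClosed_subset _
      inter_subset_left
    exact (hwc.mono hball).preimage_isClosed_of_isClosed Metric.isClosed_closedBall isClosed_Iic
  have hfin := aux_core_s19 hn μ hΩo hwcv hwc h0 hK hKc (h := δ * t) (by positivity)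
    (by simp [hw, hu0]) (by
      intro x hx
      obtain ⟨h1, h2⟩ := hwle x hx.1 hx.2
      have h3 := hunn x hx.1
      simp only [hw, inner_smul_left, RCLike.conj_to_real]
      have : δ * ⟪q, x⟫ ≤ δ * t := by
        apply mul_le_mul_of_nonneg_left _ hδ0.le
        linarith
      linarith) q (β := δ * t / (1 - δ)) (t := t) (div_pos (by positivity) (by linarith))
    (fun x hx => (hwle x hx.1 hx.2).2)
    ⟨s • e, ⟨hsΩ, by
      simp only [hw, inner_smul_left, inner_smul_right, RCLike.conj_to_real, hqe]
      rw [abs_of_neg hs] at hsu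
      have : δ * t = -(2 * δ * s) := by rw [ht]; ring
      linarith⟩, by
      rw [inner_smul_right, hqe, mul_one, abs_of_neg hs]; linarith⟩
    hlam1 hlam2
    (aux_translate μ hΩo.measurableSet 0 (δ • q) (δ * t) (by simp) (by simp [hw]) hma)
  have e5 : t / (δ * t / (1 - δ)) = C + 2 := by
    have h1 : (1 - δ) = δ * (C + 2) := by linarith
    have h2 : 0 < C + 2 := by linarith
    rw [h1]
    field_simp
  rw [e5, ← hC] at hfin
  linarith

/-- **Theorem 3.6 (ii) (Caffarelli).** If `λ₁ ≤ det ∇²v ≤ λ₂` in the sense of measure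
for a strictly convex `v` on the open convex set `Ω`, then `v` is differentiable on `Ω`
(hence `C¹`). -/
theorem stmt19 {n : ℕ} (hn : 1 ≤ n) {Ω : Set (EuclideanSpace ℝ (Fin n))}
    (hΩo : IsOpen Ω) (hΩc : Convex ℝ Ω) {lam1 lam2 : ℝ} (hlam1 : 0 < lam1) (hlam12 : lam1 < lam2)
    {v : EuclideanSpace ℝ (Fin n) → ℝ} (hvconv : StrictConvexOn ℝ Ω v)
    (hma : ∀ ω : Set (EuclideanSpace ℝ (Fin n)), MeasurableSet ω → ω ⊆ Ω →
      ENNReal.ofReal lam1 * μH[(n : ℝ)] ω ≤ maMeasure Ω v ω ∧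
        maMeasure Ω v ω ≤ ENNReal.ofReal lam2 * μH[(n : ℝ)] ω) :
    ∀ x ∈ Ω, DifferentiableAt ℝ v x := by
  intro x0 hx0
  by_contra hnd
  have hcv := hvconv.convexOn
  have hvc : ContinuousOn v Ω := hcv.continuousOn hΩo
  obtain ⟨p, hp, p', hp', e, hpe, hder⟩ := aux_nondiff hn hΩo hcv hvc hx0 hnd
  haveI : (μH[(n : ℝ)] : Measure (EuclideanSpace ℝ (Fin n))).IsAddHaarMeasure := by
    have := MeasureTheory.isAddHaarMeasure_hausdorffMeasure (E := EuclideanSpace ℝ (Fin n))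
    simpa using this
  set Ω' : Set (EuclideanSpace ℝ (Fin n)) := (fun y => x0 + y) ⁻¹' Ω with hΩ'
  set u : EuclideanSpace ℝ (Fin n) → ℝ := fun y => v (x0 + y) - v x0 - ⟪p, y⟫ with hu
  have hΩ'o : IsOpen Ω' := hΩo.preimage (by fun_prop)
  have hs1 : StrictConvexOn ℝ Ω' (fun y => v (x0 + y)) := hvconv.translate_right x0
  have hsc : StrictConvexOn ℝ Ω' u := by
    have h1 : ConcaveOn ℝ Ω' (fun x : EuclideanSpace ℝ (Fin n) => v x0 + ⟪p, x⟫) :=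
      (concaveOn_const (v x0) hs1.1).add ((innerSL ℝ p).toLinearMap.concaveOn hs1.1)
    have h2 := hs1.sub_concaveOn h1
    have e1 : u = (fun y => v (x0 + y)) - (fun x => v x0 + ⟪p, x⟫) := by
      ext y; simp [hu]; ring
    rw [e1]; exact h2
  have h0 : (0 : EuclideanSpace ℝ (Fin n)) ∈ Ω' := by simpa [hΩ'] using hx0
  have hu0 : u 0 = 0 := by simp [hu]
  have hunn : ∀ x ∈ Ω', 0 ≤ u x := by
    intro x hx
    have := hp _ hx
    simp only [add_sub_cancel_left] at this
    simp only [hu]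
    linarith
  refine aux_final hn μH[(n : ℝ)] hΩ'o hsc.convexOn (hsc.convexOn.continuousOn hΩ'o) h0 hu0 ?_
    (p' - p) e hpe ?_ ?_ hlam1 (hlam1.trans hlam12)
    (aux_translate _ hΩo.measurableSet x0 p (v x0) (fun y => Iff.rfl) (fun y => rfl) hma)
  · intro x hx hx0
    by_contra hcon
    have hux : u x = 0 := le_antisymm (not_lt.1 hcon) (hunn x hx)
    have h1 := hsc.2 h0 hx (Ne.symm hx0) (by norm_num : (0:ℝ) < 1/2) (by norm_num : (0:ℝ) < 1/2)
      (by norm_num)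
    have h2 := hunn _ (hsc.1 h0 hx (by norm_num : (0:ℝ) ≤ 1/2) (by norm_num : (0:ℝ) ≤ 1/2)
      (by norm_num))
    rw [hu0, hux] at h1
    simp only [smul_zero, add_zero] at h1
    simp only [smul_zero] at h2
    simp at h1 h2
    linarith
  · intro x hx
    have := hp' _ hx
    simp only [add_sub_cancel_left] at this
    simp only [hu, inner_sub_left]
    linarith
  · have h1 := (hder.sub_const (v x0)).sub
      (((hasDerivAt_id (0:ℝ)).mul_const ⟪p, e⟫).hasDerivWithinAt (s := Iio 0))
    simp only [one_mul, sub_self] at h1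
    refine h1.congr_of_eventuallyEq (Filter.Eventually.of_forall fun s => ?_) ?_
    · simp [hu, inner_smul_right]
    · simp [hu]
end
end
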